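/- arXiv:2111.13399 — 2 statements merged into one kernel-verified Lean document; each statement's English description precedes it below -/
import Mathlib

section
/- For all integers p ≥ q ≥ 1, the set Singular(p,q) is a convex cone in (ℝ^q)^3: it is convex and stable under multiplication by nonnegative real scalars. -/
open Matrix

/-- The eigenvalues of a Hermitian matrix, listed in decreasing order. -/
noncomputable def eigsDesc {n : ℕ} {A : Matrix (Fin n) (Fin n) ℂ} (hA : A.IsHermitian) :
    Fin n → ℝ :=
  fun i => hA.eigenvalues (Tuple.sort hA.eigenvalues i.rev)

/-- The singular values of a complex `p × q` matrix, listed in decreasing order: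
the square roots of the eigenvalues of the Hermitian matrix `Aᴴ * A`. -/
noncomputable def singularValues {p q : ℕ} (A : Matrix (Fin p) (Fin q) ℂ) : Fin q → ℝ :=
  fun i => Real.sqrt (eigsDesc (Matrix.isHermitian_conjTranspose_mul_self A) i)

/-- `sval A k` is the `k`-th singular value `τ_k(A)` of `A`, with 1-based indexing
(junk value `0` out of range). -/
noncomputable def sval {p q : ℕ} (A : Matrix (Fin p) (Fin q) ℂ) (k : ℕ) : ℝ :=
  if h : k - 1 < q then singularValues A ⟨k - 1, h⟩ else 0

/-- `SingularCone p q` is the set of triples `(τ(A), τ(B), τ(C))` of singular value vectors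
of complex `p × q` matrices `A`, `B`, `C` with `A + B + C = 0`. -/
def SingularCone (p q : ℕ) : Set ((Fin q → ℝ) × (Fin q → ℝ) × (Fin q → ℝ)) :=
  {t | ∃ A B C : Matrix (Fin p) (Fin q) ℂ, A + B + C = 0 ∧
      singularValues A = t.1 ∧ singularValues B = t.2.1 ∧ singularValues C = t.2.2}

theorem exists_submatrix_det_ne_zero {m n : Type*} [Fintype m] [Fintype n]
    (A : Matrix m n ℂ) {k : ℕ} (hk : k ≤ A.rank) :
    ∃ (r : Fin k → m) (c : Fin k → n), (A.submatrix r c).det ≠ 0 := by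
  classical
  obtain ⟨c, hc⟩ : ∃ c : Fin k → n, LinearIndependent ℂ (fun i => A.col (c i)) := by
    obtain ⟨κ, a, ha, hs, hli⟩ := exists_linearIndependent' ℂ A.col
    have : Fintype κ := Fintype.ofInjective a ha
    have hcard : Fintype.card κ = A.rank := by
      rw [Matrix.rank_eq_finrank_span_cols, ← hs, finrank_span_eq_card hli]
    have hle : Fintype.card (Fin k) ≤ Fintype.card κ := by simpa [hcard] using hk
    obtain ⟨e⟩ := Function.Embedding.nonempty_of_card_le hle
    exact ⟨a ∘ e, hli.comp e e.injective⟩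
  set B : Matrix m (Fin k) ℂ := A.submatrix id c with hB
  have hBr : Bᵀ.rank = k := by
    have : LinearIndependent ℂ Bᵀ.row := hc
    simpa using this.rank_matrix
  obtain ⟨κ, a, ha, hs, hli⟩ := exists_linearIndependent' ℂ B.row
  have : Fintype κ := Fintype.ofInjective a ha
  have hcard : Fintype.card κ = k := by
    rw [← hBr, Matrix.rank_transpose, Matrix.rank_eq_finrank_span_row, ← hs, finrank_span_eq_card hli]
  let e : Fin k ≃ κ := (Fintype.equivFinOfCardEq hcard).symm
  refine ⟨a ∘ e, c, ?_⟩
  have h2 : LinearIndependent ℂ (A.submatrix (a ∘ e) c).row := hli.comp e e.injective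
  have := Matrix.linearIndependent_rows_iff_isUnit.1 h2
  exact ((Matrix.isUnit_iff_isUnit_det _).1 this).ne_zero

theorem le_rank_of_submatrix_det_ne_zero {m n : Type*} [Fintype m] [Fintype n]
    (A : Matrix m n ℂ) {k : ℕ} (r : Fin k → m) (c : Fin k → n)
    (h : (A.submatrix r c).det ≠ 0) : k ≤ A.rank := by
  classical
  have h1 := Matrix.rank_of_det_ne_zero h
  have h2 := Matrix.rank_submatrix_le A r c
  simpa [h1] using h2

theorem homogeneousComponent_mul_of_isHomogeneous {σ k : Type*} [CommSemiring k]
    {g f : MvPolynomial σ k} {d n : ℕ} (hf : f.IsHomogeneous d) (hd : d ≤ n) :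
    MvPolynomial.homogeneousComponent n (g * f) =
      MvPolynomial.homogeneousComponent (n - d) g * f := by
  let _ : GradedAlgebra (MvPolynomial.homogeneousSubmodule σ k) := MvPolynomial.gradedAlgebra
  have := DirectSum.coe_decompose_mul_of_right_mem_of_le
    (MvPolynomial.homogeneousSubmodule σ k) (a := g) (b := f) (n := n) (i := d) hf hd
  have key (p : MvPolynomial σ k) (i : ℕ) :
      (DirectSum.decompose (MvPolynomial.homogeneousSubmodule σ k) p i : MvPolynomial σ k) =
        MvPolynomial.homogeneousComponent i p :=
    MvPolynomial.decomposition.decompose'_apply p i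
  rwa [key, key] at this

theorem exists_homogeneous_combination_eq_X_pow {σ J : Type*} [Fintype σ] [Fintype J]
    (f : J → MvPolynomial σ ℂ) (d : J → ℕ) (hf : ∀ j, (f j).IsHomogeneous (d j))
    (h : ∀ x : σ → ℂ, (∀ j, MvPolynomial.eval x (f j) = 0) → x = 0) :
    ∃ N : ℕ, 0 < N ∧ (∀ j, d j ≤ N) ∧ ∀ s, ∃ g : J → MvPolynomial σ ℂ,
      (∀ j, (g j).IsHomogeneous (N - d j)) ∧ ∑ j, g j * f j = MvPolynomial.X s ^ N := by
  classical
  have hrad : ∀ s, ∃ n : ℕ, (MvPolynomial.X s : MvPolynomial σ ℂ) ^ n ∈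
      Ideal.span (Set.range f) := by
    intro s
    have : (MvPolynomial.X s : MvPolynomial σ ℂ) ∈ (Ideal.span (Set.range f)).radical := by
      rw [← MvPolynomial.vanishingIdeal_zeroLocus_eq_radical (K := ℂ),
        MvPolynomial.mem_vanishingIdeal_iff, MvPolynomial.zeroLocus_span]
      intro x hx
      have hx0 : x = 0 := h x fun j => by
        have := hx (f j) ⟨j, rfl⟩
        rwa [MvPolynomial.aeval_eq_eval] at this
      simp [hx0]
    exact this
  choose n hn using hrad
  refine ⟨1 + ∑ s, n s + ∑ j, d j, by omega, fun j => ?_, fun s => ?_⟩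
  · have := Finset.single_le_sum (f := d) (fun i _ => Nat.zero_le _) (Finset.mem_univ j)
    omega
  set N := 1 + ∑ s, n s + ∑ j, d j with hN
  have hle : n s ≤ N := by
    have := Finset.single_le_sum (f := n) (fun i _ => Nat.zero_le _) (Finset.mem_univ s)
    omega
  have hmem : (MvPolynomial.X s : MvPolynomial σ ℂ) ^ N ∈ Ideal.span (Set.range f) := by
    rw [← Nat.sub_add_cancel hle, pow_add]
    exact Ideal.mul_mem_left _ _ (hn s)
  obtain ⟨g, hg⟩ := Ideal.mem_span_range_iff_exists_fun.1 hmem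
  refine ⟨fun j => MvPolynomial.homogeneousComponent (N - d j) (g j),
    fun j => MvPolynomial.homogeneousComponent_isHomogeneous _ _, ?_⟩
  have h1 := congrArg (MvPolynomial.homogeneousComponent N) hg
  rw [map_sum, MvPolynomial.homogeneousComponent_eq_self
    (MvPolynomial.isHomogeneous_X_pow s N)] at h1
  rw [← h1]
  refine Finset.sum_congr rfl fun j _ => ?_
  rw [homogeneousComponent_mul_of_isHomogeneous (hf j)]
  have := Finset.single_le_sum (f := d) (fun i _ => Nat.zero_le _) (Finset.mem_univ j)
  omega

theorem exists_resultant {σ J R : Type*} [Fintype σ] [Fintype J] [CommRing R] [Algebra ℂ R]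
    (f : J → MvPolynomial σ R) (d : J → ℕ) (hf : ∀ j, (f j).IsHomogeneous (d j))
    (φ₀ : R →ₐ[ℂ] ℂ)
    (h : ∀ x : σ → ℂ, (∀ j, MvPolynomial.eval x (MvPolynomial.map φ₀.toRingHom (f j)) = 0) →
      x = 0) :
    ∃ D : R, φ₀ D ≠ 0 ∧ ∀ φ : R →ₐ[ℂ] ℂ, φ D ≠ 0 → ∀ x : σ → ℂ,
      (∀ j, MvPolynomial.eval x (MvPolynomial.map φ.toRingHom (f j)) = 0) → x = 0 := by
  classical
  rcases isEmpty_or_nonempty σ with hσ | hσ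
  · exact ⟨1, by simp, fun φ _ x _ => Subsingleton.elim _ _⟩
  obtain ⟨N, hN0, hdN, hg⟩ := exists_homogeneous_combination_eq_X_pow
    (fun j => MvPolynomial.map φ₀.toRingHom (f j)) d (fun j => (hf j).map _) h
  choose g hghom hgsum using hg
  let F : σ → MvPolynomial σ R := fun s =>
    ∑ j, MvPolynomial.map (algebraMap ℂ R) (g s j) * f j
  have hF : ∀ s, (F s).IsHomogeneous N := fun s => by
    refine MvPolynomial.IsHomogeneous.sum _ _ _ fun j _ => ?_
    have := ((hghom s j).map (algebraMap ℂ R)).mul (hf j)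
    rwa [Nat.sub_add_cancel (hdN j)] at this
  have hF0 : ∀ s, MvPolynomial.map φ₀.toRingHom (F s) = MvPolynomial.X s ^ N := fun s => by
    rw [← hgsum s, map_sum]
    refine Finset.sum_congr rfl fun j _ => ?_
    rw [map_mul, MvPolynomial.map_map]
    congr 1
    have : φ₀.toRingHom.comp (algebraMap ℂ R) = RingHom.id ℂ := by
      ext z; simp
    rw [this, MvPolynomial.map_id]
  set K := Fintype.card σ * N with hK
  let T := (Finset.univ : Finset σ).finsuppAntidiag K
  have hT : ∀ m : σ →₀ ℕ, m ∈ T ↔ m.degree = K := fun m => by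
    simp [T, Finset.mem_finsuppAntidiag, Finsupp.degree_eq_sum]
  have hpig : ∀ m : T, ∃ s, N ≤ (m : σ →₀ ℕ) s := by
    rintro ⟨m, hm⟩
    rw [hT, Finsupp.degree_eq_sum] at hm
    obtain ⟨s, -, hs⟩ := Finset.exists_le_of_sum_le (s := (Finset.univ : Finset σ))
      (f := fun _ => N) (g := fun s => m s) Finset.univ_nonempty (by simp [hm, hK])
    exact ⟨s, hs⟩
  choose s hs using hpig
  let P : T → MvPolynomial σ R := fun m =>
    MvPolynomial.monomial ((m : σ →₀ ℕ) - Finsupp.single (s m) N) 1 * F (s m)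
  have hsub : ∀ m : T, ((m : σ →₀ ℕ) - Finsupp.single (s m) N) + Finsupp.single (s m) N = m :=
    fun m => tsub_add_cancel_of_le (by simpa using hs m)
  have hP : ∀ m, (P m).IsHomogeneous K := fun m => by
    have h1 : ((m : σ →₀ ℕ) - Finsupp.single (s m) N).degree + N = K := by
      have := congrArg Finsupp.degree (hsub m)
      rw [map_add, (hT m).1 m.2, Finsupp.degree_single] at this
      exact this
    rw [← h1]
    exact (MvPolynomial.isHomogeneous_monomial 1 rfl).mul (hF _)
  let M : Matrix T T R := Matrix.of fun m m' => MvPolynomial.coeff (m' : σ →₀ ℕ) (P m)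
  have hM0 : φ₀.mapMatrix M = 1 := by
    ext m m'
    have : φ₀ (MvPolynomial.coeff (m' : σ →₀ ℕ) (P m)) =
        MvPolynomial.coeff (m' : σ →₀ ℕ) (MvPolynomial.map φ₀.toRingHom (P m)) := by
      rw [MvPolynomial.coeff_map]; rfl
    simp only [AlgHom.mapMatrix_apply, Matrix.map_apply, M, Matrix.of_apply, this, P, map_mul, hF0,
      MvPolynomial.map_monomial, MvPolynomial.X_pow_eq_monomial, MvPolynomial.monomial_mul, hsub]
    rw [MvPolynomial.coeff_monomial, Matrix.one_apply, map_one, mul_one]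
    exact if_congr Subtype.ext_iff.symm rfl rfl
  refine ⟨M.det, ?_, fun φ hφ x hx => ?_⟩
  · rw [AlgHom.map_det, hM0]; simp
  by_contra hx0
  apply hφ
  rw [AlgHom.map_det, ← Matrix.exists_mulVec_eq_zero_iff]
  refine ⟨fun m => ∏ i, x i ^ (m : σ →₀ ℕ) i, ?_, ?_⟩
  · obtain ⟨i, hi⟩ := Function.ne_iff.1 hx0
    have hm : Finsupp.single i K ∈ T := by rw [hT]; simp
    refine Function.ne_iff.2 ⟨⟨_, hm⟩, ?_⟩
    simp only [Pi.zero_apply] at hi ⊢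
    refine Finset.prod_ne_zero_iff.2 fun l _ => ?_
    by_cases hl : l = i
    · subst hl; exact pow_ne_zero _ hi
    · simp [Ne.symm hl]
  · ext m
    have hPev : MvPolynomial.eval x (MvPolynomial.map φ.toRingHom (P m)) = 0 := by
      simp only [P, F, map_mul, map_sum, hx, mul_zero, Finset.sum_const_zero]
    rw [MvPolynomial.eval_map, MvPolynomial.eval₂_eq'] at hPev
    simp only [Matrix.mulVec, dotProduct, AlgHom.mapMatrix_apply, Matrix.map_apply, M,
      Matrix.of_apply, Pi.zero_apply]
    rw [← hPev, Finset.sum_coe_sort T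
      (fun m' => φ (MvPolynomial.coeff m' (P m)) * ∏ i, x i ^ m' i)]
    symm
    apply Finset.sum_subset
    · intro m' hm'
      rw [hT]
      by_contra hne
      exact MvPolynomial.mem_support_iff.1 hm' ((hP m).coeff_eq_zero hne)
    · intro m' _ hm'
      rw [MvPolynomial.notMem_support_iff.1 hm']
      simp

/-- The diagonal projection onto the coordinates in `s`. -/
def coordProj {ι : Type*} [DecidableEq ι] (R : Type*) [Zero R] [One R] (s : Finset ι) :
    Matrix ι ι R :=
  Matrix.diagonal fun i => if i ∈ s then 1 else 0

/-- The rank inequality `b rank L ≤ ∑ⱼ aⱼ rank (L gⱼ Eⱼ)` for all square matrices `L`. -/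
def RankBound {ι Λ : Type*} [Fintype ι] [DecidableEq ι] [Fintype Λ] (s : Λ → Finset ι)
    (a : Λ → ℝ) (b : ℝ) (g : Λ → Matrix ι ι ℂ) : Prop :=
  ∀ L : Matrix ι ι ℂ, b * L.rank ≤ ∑ j, a j * (L * g j * coordProj ℂ (s j)).rank

/-- The flattening of a tensor `ω`, whose row space is the span of all contractions of `ω`. -/
def contractionMatrix {ι S : Type*} {r : ℕ} (ω : (Fin r → ι) → S) :
    Matrix (Fin r × (Fin r → ι)) ι S :=
  Matrix.of fun k x => ω (Function.update k.2 k.1 x)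

theorem contractionMatrix_minors {m ι : Type*} {r : ℕ} (L : Matrix m ι ℂ) (f : Fin r → m) :
    contractionMatrix (fun i => (L.submatrix f i).det) =
      (Matrix.of fun (k : Fin r × (Fin r → ι)) l => (L.submatrix f k.2).adjugate k.1 l) *
        L.submatrix f id := by
  ext k x
  have h1 : L.submatrix f (Function.update k.2 k.1 x) =
      (L.submatrix f k.2).updateCol k.1 (fun l => L (f l) x) := by
    ext l k'
    by_cases hk : k' = k.1
    · subst hk; simp
    · simp [hk]
  simp only [contractionMatrix, Matrix.of_apply]
  rw [h1, ← Matrix.cramer_apply, Matrix.cramer_eq_adjugate_mulVec]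
  rfl

section Generic

variable {ι Λ R : Type*} [Fintype ι] [DecidableEq ι] [Fintype Λ]

theorem RankBound.add {s : Λ → Finset ι} {a a' : Λ → ℝ} {b b' : ℝ} {g : Λ → Matrix ι ι ℂ}
    (h : RankBound s a b g) (h' : RankBound s a' b' g) :
    RankBound s (a + a') (b + b') g := fun L => by
  simp only [add_mul, Pi.add_apply, Finset.sum_add_distrib]
  exact add_le_add (h L) (h' L)

open scoped ComplexOrder in
theorem RankBound.le {s : Λ → Finset ι} {a : Λ → ℝ} {b : ℝ} {g : Λ → Matrix ι ι ℂ}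
    (ha : ∀ j, 0 ≤ a j) (h : RankBound s a b g) {m : Type*} [Fintype m] (L : Matrix m ι ℂ) :
    b * L.rank ≤ ∑ j, a j * (L * g j * coordProj ℂ (s j)).rank := by
  have h1 := h (Lᴴ * L)
  rw [Matrix.rank_conjTranspose_mul_self] at h1
  refine h1.trans (Finset.sum_le_sum fun j _ => mul_le_mul_of_nonneg_left ?_ (ha j))
  have h2 : Lᴴ * L * g j * coordProj ℂ (s j) = Lᴴ * (L * g j * coordProj ℂ (s j)) := by
    simp only [Matrix.mul_assoc]
  rw [h2]
  exact Nat.cast_le.2 (Matrix.rank_mul_le_right _ _)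

theorem isHomogeneous_det {σ n S : Type*} [Fintype n] [DecidableEq n] [CommRing S]
    (M : Matrix n n (MvPolynomial σ S)) (h : ∀ i j, (M i j).IsHomogeneous 1) :
    M.det.IsHomogeneous (Fintype.card n) := by
  rw [Matrix.det_apply]
  refine MvPolynomial.IsHomogeneous.sum _ _ _ fun τ _ => ?_
  have h1 : (∏ i, M (τ i) i).IsHomogeneous (Fintype.card n) := by
    have := MvPolynomial.IsHomogeneous.prod Finset.univ (fun i => M (τ i) i) (fun _ => 1)
      fun i _ => h _ _
    simpa using this
  rcases Int.units_eq_one_or (Equiv.Perm.sign τ) with h2 | h2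
  · simpa [h2] using h1
  · simpa [h2] using h1.neg

theorem le_rank_contractionMatrix {r : ℕ} {ω : (Fin r → ι) → ℂ} (hω : ω ≠ 0)
    (h : ∀ i, ¬ Function.Injective i → ω i = 0) : r ≤ (contractionMatrix ω).rank := by
  obtain ⟨i, hi⟩ := Function.ne_iff.1 hω
  have hinj : Function.Injective i := by
    by_contra hc
    exact hi (h i hc)
  refine le_rank_of_submatrix_det_ne_zero _ (fun k => (k, i)) i ?_
  have : (contractionMatrix ω).submatrix (fun k => (k, i)) i =
      Matrix.diagonal fun _ => ω i := by
    ext k k'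
    simp only [contractionMatrix, Matrix.submatrix_apply, Matrix.of_apply, Matrix.diagonal_apply]
    split_ifs with hk
    · subst hk; simp
    · refine h _ fun hc => hk (hc ?_)
      simp [Function.update_of_ne (Ne.symm hk)]
  rw [this, Matrix.det_diagonal]
  exact Finset.prod_ne_zero_iff.2 fun _ _ => hi

theorem exists_generic_rank_gt [CommRing R] [Algebra ℂ R] (s : Λ → Finset ι) (r : ℕ) (ρ : Λ → ℕ)
    (G : Λ → Matrix ι ι R) (φ₀ : R →ₐ[ℂ] ℂ)
    (h : ∀ L : Matrix (Fin r × (Fin r → ι)) ι ℂ, r ≤ L.rank →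
      ∃ j, ρ j < (L * (G j).map φ₀ * coordProj ℂ (s j)).rank) :
    ∃ D : R, φ₀ D ≠ 0 ∧ ∀ φ : R →ₐ[ℂ] ℂ, φ D ≠ 0 → ∀ L : Matrix ι ι ℂ, L.rank = r →
      ∃ j, ρ j < (L * (G j).map φ * coordProj ℂ (s j)).rank := by
  classical
  let Q : Λ → Matrix (Fin r × (Fin r → ι)) ι (MvPolynomial (Fin r → ι) R) := fun j =>
    contractionMatrix (fun i : (Fin r → ι) => (MvPolynomial.X i : MvPolynomial (Fin r → ι) R)) *
      ((G j).map MvPolynomial.C : Matrix ι ι (MvPolynomial (Fin r → ι) R)) * coordProj (MvPolynomial (Fin r → ι) R) (s j)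
  let J := (Fin r → ι) ⊕ (Σ j : Λ, (Fin (ρ j + 1) → Fin r × (Fin r → ι)) × (Fin (ρ j + 1) → ι))
  let F : J → MvPolynomial (Fin r → ι) R := Sum.elim
    (fun i => if Function.Injective i then 0 else MvPolynomial.X i)
    (fun t => ((Q t.1).submatrix t.2.1 t.2.2).det)
  let d : J → ℕ := Sum.elim (fun _ => 1) (fun t => ρ t.1 + 1)
  have hF : ∀ j, (F j).IsHomogeneous (d j) := by
    rintro (i | t)
    · simp only [F, d, Sum.elim_inl]
      split_ifs
      · exact MvPolynomial.isHomogeneous_zero _ _ _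
      · exact MvPolynomial.isHomogeneous_X _ _
    · simp only [F, d, Sum.elim_inr]
      have := isHomogeneous_det ((Q t.1).submatrix t.2.1 t.2.2) fun i k => ?_
      · simpa using this
      simp only [Matrix.submatrix_apply, Q, coordProj, Matrix.mul_diagonal]
      have h1 : (((contractionMatrix (fun i : (Fin r → ι) => (MvPolynomial.X i : MvPolynomial (Fin r → ι) R))) *
          ((G t.1).map MvPolynomial.C : Matrix ι ι (MvPolynomial (Fin r → ι) R))) (t.2.1 i) (t.2.2 k)).IsHomogeneous 1 := by
        rw [Matrix.mul_apply]
        exact MvPolynomial.IsHomogeneous.sum _ _ _ fun x _ =>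
          (MvPolynomial.isHomogeneous_X _ _).mul (MvPolynomial.isHomogeneous_C _ _)
      split_ifs
      · simpa using h1
      · simpa using MvPolynomial.isHomogeneous_zero _ _ _
  have hQ : ∀ (φ : R →ₐ[ℂ] ℂ) (ω : (Fin r → ι) → ℂ) (t),
      MvPolynomial.eval ω (MvPolynomial.map φ.toRingHom (F (Sum.inr t))) =
        ((contractionMatrix ω * (G t.1).map φ * coordProj ℂ (s t.1)).submatrix
          t.2.1 t.2.2).det := by
    intro φ ω t
    simp only [F, Sum.elim_inr]
    rw [← RingHom.comp_apply, RingHom.map_det]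
    congr 1
    rw [RingHom.mapMatrix_apply, ← Matrix.submatrix_map]
    congr 1
    simp only [Q, Matrix.map_mul, Matrix.map_map]
    congr 1
    · congr 1
      · ext k x; simp [contractionMatrix]
      · ext k x; simp
    · rw [coordProj, coordProj, Matrix.diagonal_map (map_zero _)]
      congr 1
      ext i
      split_ifs <;> simp
  have hin : ∀ (φ : R →ₐ[ℂ] ℂ) (ω : (Fin r → ι) → ℂ) (i : (Fin r → ι)),
      MvPolynomial.eval ω (MvPolynomial.map φ.toRingHom (F (Sum.inl i))) =
        if Function.Injective i then 0 else ω i := by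
    intro φ ω i
    simp only [F, Sum.elim_inl]
    split_ifs <;> simp
  obtain ⟨D, hD, hD'⟩ := exists_resultant F d hF φ₀ fun ω hω => by
    by_contra hne
    obtain ⟨j, hj⟩ := h (contractionMatrix ω) (le_rank_contractionMatrix hne fun i hi => by
      have := hω (Sum.inl i)
      rwa [hin, if_neg hi] at this)
    obtain ⟨f, c, hfc⟩ := exists_submatrix_det_ne_zero _ (Nat.succ_le_of_lt hj)
    have := hω (Sum.inr ⟨j, f, c⟩)
    rw [hQ] at this
    exact hfc this
  refine ⟨D, hD, fun φ hφ L hL => ?_⟩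
  by_contra! hc
  obtain ⟨f, c, hfc⟩ := exists_submatrix_det_ne_zero L hL.ge
  have := hD' φ hφ (fun i => (L.submatrix f i).det) ?_
  · exact hfc (congrFun this c)
  rintro (i | t)
  · rw [hin]
    split_ifs with hi
    · rfl
    · simp only [Function.Injective, not_forall] at hi
      obtain ⟨k, l, hkl, hne⟩ := hi
      exact Matrix.det_zero_of_column_eq hne fun x => by simp [hkl]
  · rw [hQ]
    by_contra hne
    have h1 := le_rank_of_submatrix_det_ne_zero _ _ _ hne
    rw [contractionMatrix_minors, Matrix.mul_assoc, Matrix.mul_assoc] at h1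
    have h2 := h1.trans (Matrix.rank_mul_le_right _ _)
    have h3 : L.submatrix f id * ((G t.1).map φ * coordProj ℂ (s t.1)) =
        (L * (G t.1).map φ * coordProj ℂ (s t.1)).submatrix f id := by
      rw [Matrix.mul_assoc]; rfl
    rw [h3] at h2
    have h4 := h2.trans (Matrix.rank_submatrix_le _ f id)
    have := hc t.1
    omega

/-- The rank bound is a generic condition on a family of matrices over a `ℂ`-algebra. -/
theorem RankBound.exists_generic [CommRing R] [Algebra ℂ R] {s : Λ → Finset ι} {a : Λ → ℝ}
    {b : ℝ} (ha : ∀ j, 0 ≤ a j) (G : Λ → Matrix ι ι R) (φ₀ : R →ₐ[ℂ] ℂ)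
    (hb : 0 ≤ b) (h : RankBound s a b fun j => (G j).map φ₀) :
    ∃ D : R, φ₀ D ≠ 0 ∧ ∀ φ : R →ₐ[ℂ] ℂ, φ D ≠ 0 → RankBound s a b fun j => (G j).map φ := by
  classical
  let n := Fintype.card ι
  have key : ∀ t : Fin (n + 1) × (Λ → Fin (n + 1)), ∃ D : R, φ₀ D ≠ 0 ∧
      (∑ j, a j * (t.2 j : ℕ) < b * (t.1 : ℕ) → ∀ φ : R →ₐ[ℂ] ℂ, φ D ≠ 0 →
        ∀ L : Matrix ι ι ℂ, L.rank = t.1 →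
          ∃ j, (t.2 j : ℕ) < (L * (G j).map φ * coordProj ℂ (s j)).rank) := by
    intro t
    by_cases ht : ∑ j, a j * (t.2 j : ℕ) < b * (t.1 : ℕ)
    · obtain ⟨D, hD, hD'⟩ := exists_generic_rank_gt s t.1 (fun j => t.2 j) G φ₀ fun L hL => by
        by_contra! hc
        have h1 := h.le ha L
        have h2 : ∑ j, a j * (L * (G j).map φ₀ * coordProj ℂ (s j)).rank ≤
            ∑ j, a j * (t.2 j : ℕ) := Finset.sum_le_sum fun j _ =>
          mul_le_mul_of_nonneg_left (by exact_mod_cast hc j) (ha j)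
        have h3 : b * (t.1 : ℕ) ≤ b * L.rank :=
          mul_le_mul_of_nonneg_left (by exact_mod_cast hL) hb
        linarith
      exact ⟨D, hD, fun _ => hD'⟩
    · exact ⟨1, by simp, fun h' => absurd h' ht⟩
  choose D hD hD' using key
  refine ⟨∏ t, D t, by rw [map_prod]; exact Finset.prod_ne_zero_iff.2 fun t _ => hD t,
    fun φ hφ L => ?_⟩
  rw [map_prod, Finset.prod_ne_zero_iff] at hφ
  by_contra! hc
  have hle : ∀ M : Matrix ι ι ℂ, M.rank < n + 1 := fun M =>
    Nat.lt_succ_of_le (Matrix.rank_le_card_width M)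
  obtain ⟨j, hj⟩ := hD' (⟨L.rank, hle _⟩, fun j => ⟨_, hle (L * (G j).map φ * coordProj ℂ (s j))⟩)
    hc φ (hφ _ (Finset.mem_univ _)) L rfl
  exact lt_irrefl _ hj

end Generic

theorem conjTranspose_coordProj {ι : Type*} [DecidableEq ι] (s : Finset ι) : (coordProj ℂ s)ᴴ = coordProj ℂ s := by
  rw [coordProj, Matrix.diagonal_conjTranspose]
  congr 1
  ext i
  by_cases h : i ∈ s <;> simp [h]

section Balanced

open scoped ComplexOrder

variable {ι Λ : Type*} [Fintype ι] [DecidableEq ι] [Fintype Λ]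

theorem Matrix.IsHermitian.exists_unitary_diagonal {A : Matrix ι ι ℂ} (hA : A.IsHermitian) :
    ∃ U : Matrix ι ι ℂ, Uᴴ * U = 1 ∧ U * Uᴴ = 1 ∧
      A = U * Matrix.diagonal (fun i => (hA.eigenvalues i : ℂ)) * Uᴴ := by
  refine ⟨hA.eigenvectorUnitary, ?_, ?_, ?_⟩
  · exact Unitary.coe_star_mul_self hA.eigenvectorUnitary
  · exact Unitary.coe_mul_star_self hA.eigenvectorUnitary
  · exact hA.spectral_theorem.trans (Unitary.conjStarAlgAut_apply _ _)

theorem re_trace_le_rank {A : Matrix ι ι ℂ} (hA : A.IsHermitian) (h : (1 - A).PosSemidef) :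
    A.trace.re ≤ A.rank := by
  have hle : ∀ i, hA.eigenvalues i ≤ 1 := fun i => by
    have h1 := h.dotProduct_mulVec_nonneg (hA.eigenvectorBasis i).ofLp
    rw [Matrix.sub_mulVec, Matrix.one_mulVec, dotProduct_sub] at h1
    have h2 := hA.eigenvalues_eq i
    have h3 : star (hA.eigenvectorBasis i).ofLp ⬝ᵥ (hA.eigenvectorBasis i).ofLp = 1 := by
      have := hA.eigenvectorBasis.orthonormal.1 i
      have h4 := inner_self_eq_norm_sq_to_K (𝕜 := ℂ) (hA.eigenvectorBasis i)
      rw [this, EuclideanSpace.inner_eq_star_dotProduct, dotProduct_comm] at h4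
      simpa using h4
    rw [h3] at h1
    have h4 := (Complex.le_def.1 h1).1
    simp only [Complex.sub_re, Complex.one_re, Complex.zero_re] at h4
    rw [h2]
    simpa using h4
  rw [hA.trace_eq_sum_eigenvalues, hA.rank_eq_card_non_zero_eigs, Fintype.card_subtype,
    Finset.card_filter]
  push_cast
  rw [Complex.re_sum]
  refine Finset.sum_le_sum fun i _ => ?_
  split_ifs with hi
  · simpa using hle i
  · simpa using (not_not.1 hi).le

theorem exists_projection_onto_rows (L : Matrix ι ι ℂ) :
    ∃ P Z : Matrix ι ι ℂ, P = Z * L ∧ P.IsHermitian ∧ P * P = P ∧ P.trace = L.rank := by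
  have hA := Matrix.isHermitian_conjTranspose_mul_self L
  obtain ⟨U, hU, hU', hd⟩ := hA.exists_unitary_diagonal
  set e := hA.eigenvalues with he
  let χ : Matrix ι ι ℂ := Matrix.diagonal fun i => if e i = 0 then 0 else 1
  let D' : Matrix ι ι ℂ := Matrix.diagonal fun i => ((e i : ℂ))⁻¹
  refine ⟨U * χ * Uᴴ, U * D' * Uᴴ * Lᴴ, ?_, ?_, ?_, ?_⟩
  · rw [Matrix.mul_assoc _ Lᴴ, hd]
    have : U * D' * Uᴴ * (U * Matrix.diagonal (fun i => (e i : ℂ)) * Uᴴ) =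
        U * (D' * (Uᴴ * U) * Matrix.diagonal (fun i => (e i : ℂ))) * Uᴴ := by
      simp only [Matrix.mul_assoc]
    rw [this, hU, Matrix.mul_one, Matrix.diagonal_mul_diagonal]
    simp only [χ]
    congr 3
    ext i
    by_cases h : e i = 0 <;> simp [h]
  · simp only [Matrix.IsHermitian, Matrix.conjTranspose_mul, Matrix.conjTranspose_conjTranspose, χ,
      Matrix.diagonal_conjTranspose, Matrix.mul_assoc]
    congr 3
    ext i
    by_cases h : e i = 0 <;> simp [h]
  · have : U * χ * Uᴴ * (U * χ * Uᴴ) = U * (χ * (Uᴴ * U) * χ) * Uᴴ := by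
      simp only [Matrix.mul_assoc]
    rw [this, hU, Matrix.mul_one, Matrix.diagonal_mul_diagonal]
    congr 3
    ext i
    by_cases h : e i = 0 <;> simp [h]
  · rw [Matrix.trace_mul_comm, ← Matrix.mul_assoc, hU, Matrix.one_mul, Matrix.trace_diagonal,
      ← Matrix.rank_conjTranspose_mul_self, hA.rank_eq_card_non_zero_eigs, Fintype.card_subtype,
      Finset.card_filter]
    push_cast
    refine Finset.sum_congr rfl fun i _ => ?_
    by_cases h : e i = 0
    · simp [← he, h]
    · simp [← he, h]

theorem coordProj_mul_self (s : Finset ι) : coordProj ℂ s * coordProj ℂ s = coordProj ℂ s := by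
  rw [coordProj, Matrix.diagonal_mul_diagonal]
  congr 1
  ext i
  split_ifs <;> simp

theorem coordProj_add_compl (s : Finset ι) : coordProj ℂ s + coordProj ℂ sᶜ = 1 := by
  rw [coordProj, coordProj, Matrix.diagonal_add, ← Matrix.diagonal_one]
  congr 1
  ext i
  by_cases h : i ∈ s <;> simp [h]

theorem RankBound.of_balanced {s : Λ → Finset ι} {a : Λ → ℝ} {b : ℝ} {g : Λ → Matrix ι ι ℂ}
    (ha : ∀ j, 0 ≤ a j) (hg : ∀ j, g j * (g j)ᴴ = 1)
    (h : ∑ j, (a j : ℂ) • (g j * coordProj ℂ (s j) * (g j)ᴴ) = (b : ℂ) • 1) :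
    RankBound s a b g := by
  intro L
  obtain ⟨P, Z, hPZ, hPh, hPP, hPt⟩ := exists_projection_onto_rows L
  have h1 : (b : ℂ) * L.rank = ∑ j, (a j : ℂ) * (P * (g j * coordProj ℂ (s j) * (g j)ᴴ)).trace := by
    have := congrArg (fun M => (P * M).trace) h
    simp only [Matrix.mul_sum, Matrix.mul_smul, Matrix.trace_sum, Matrix.trace_smul, Matrix.mul_one,
      hPt, smul_eq_mul] at this
    exact this.symm
  have h2 : b * L.rank = ∑ j, a j * (P * (g j * coordProj ℂ (s j) * (g j)ᴴ)).trace.re := by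
    have := congrArg Complex.re h1
    simpa [Complex.re_sum] using this
  rw [h2]
  refine Finset.sum_le_sum fun j _ => mul_le_mul_of_nonneg_left ?_ (ha j)
  let X : Finset ι → Matrix ι ι ℂ := fun t => P * g j * coordProj ℂ t
  have hX : ∀ t, X t * (X t)ᴴ = P * (g j * coordProj ℂ t * (g j)ᴴ) * P := fun t => by
    simp only [X, Matrix.conjTranspose_mul, conjTranspose_coordProj, hPh.eq]
    have : P * g j * coordProj ℂ t * (coordProj ℂ t * ((g j)ᴴ * P)) =
        P * g j * (coordProj ℂ t * coordProj ℂ t) * ((g j)ᴴ * P) := by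
      simp only [Matrix.mul_assoc]
    rw [this, coordProj_mul_self]
    simp only [Matrix.mul_assoc]
  have hsum : X (s j) * (X (s j))ᴴ + X (s j)ᶜ * (X (s j)ᶜ)ᴴ = P := by
    rw [hX, hX, ← Matrix.add_mul, ← Matrix.mul_add, ← Matrix.add_mul, ← Matrix.mul_add,
      coordProj_add_compl, Matrix.mul_one, hg, Matrix.mul_one, hPP]
  have htr : (P * (g j * coordProj ℂ (s j) * (g j)ᴴ)).trace = (X (s j) * (X (s j))ᴴ).trace := by
    rw [hX, Matrix.trace_mul_comm _ P, ← Matrix.mul_assoc P P, hPP]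
  have hpsd : (1 - X (s j) * (X (s j))ᴴ).PosSemidef := by
    have h3 : 1 - X (s j) * (X (s j))ᴴ = (1 - P) * (1 - P)ᴴ + X (s j)ᶜ * (X (s j)ᶜ)ᴴ := by
      have : (1 - P) * (1 - P)ᴴ = 1 - P := by
        rw [Matrix.conjTranspose_sub, hPh.eq, Matrix.conjTranspose_one, Matrix.sub_mul,
          Matrix.mul_sub, Matrix.mul_sub, hPP]
        simp
      rw [this, ← hsum]
      abel
    rw [h3]
    exact (Matrix.posSemidef_self_mul_conjTranspose _).add
      (Matrix.posSemidef_self_mul_conjTranspose _)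
  rw [htr]
  refine (re_trace_le_rank (Matrix.isHermitian_mul_conjTranspose_self _) hpsd).trans ?_
  rw [Matrix.rank_self_mul_conjTranspose]
  have : X (s j) = Z * (L * g j * coordProj ℂ (s j)) := by
    simp only [X, hPZ, Matrix.mul_assoc]
  rw [this]
  exact Nat.cast_le.2 (Matrix.rank_mul_le_right _ _)

end Balanced

section DetLowerBound

open scoped ComplexOrder

variable {ι κ : Type*} [Fintype ι] [DecidableEq ι] [Fintype κ] [DecidableEq κ]

theorem one_le_re_det_one_add {B : Matrix κ κ ℂ} (hB : B.PosSemidef) :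
    ∃ t : ℝ, 1 ≤ t ∧ (1 + B).det = t := by
  obtain ⟨U, hU, hU', hd⟩ := hB.isHermitian.exists_unitary_diagonal
  refine ⟨∏ i, (1 + hB.isHermitian.eigenvalues i), ?_, ?_⟩
  · exact Finset.prod_induction _ (fun t : ℝ => 1 ≤ t) (fun _ _ => one_le_mul_of_one_le_of_one_le)
      le_rfl fun i _ => by linarith [hB.eigenvalues_nonneg i]
  · have h1 : 1 + B =
        U * Matrix.diagonal (fun i => (1 + hB.isHermitian.eigenvalues i : ℂ)) * Uᴴ := by
      rw [← Matrix.diagonal_add, Matrix.mul_add, Matrix.add_mul, ← hd, Matrix.diagonal_one,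
        Matrix.mul_one, hU']
    rw [h1, Matrix.det_mul, Matrix.det_mul, mul_right_comm, ← Matrix.det_mul, hU',
      Matrix.det_diagonal]
    simp

theorem conjTranspose_mul_diagonal_mul_apply {ι κ : Type*} [Fintype ι] [DecidableEq ι]
    (M : Matrix ι κ ℂ) (d : ι → ℂ) (i j : κ) :
    (Mᴴ * Matrix.diagonal d * M) i j = ∑ k, star (M k i) * d k * M k j := by
  rw [Matrix.mul_apply]
  simp only [Matrix.mul_diagonal, Matrix.conjTranspose_apply]

theorem prod_mul_normSq_det_submatrix_le (M : Matrix ι κ ℂ) {d : ι → ℝ} (hd : ∀ k, 0 < d k)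
    (r : κ → ι) (hr : (M.submatrix r id).det ≠ 0) :
    (∏ l, d (r l)) * ‖(M.submatrix r id).det‖ ^ 2 ≤
      (Mᴴ * Matrix.diagonal (fun k => (d k : ℂ)) * M).det.re := by
  classical
  have hinj : Function.Injective r := by
    intro k l hkl
    by_contra hne
    exact hr (Matrix.det_zero_of_row_eq hne (by ext x; simp [hkl]))
  let N : Matrix κ κ ℂ := Matrix.diagonal (fun l => (Real.sqrt (d (r l)) : ℂ)) * M.submatrix r id
  let e : ι → ℝ := fun k => if k ∈ Set.range r then 0 else d k
  let B : Matrix κ κ ℂ := Mᴴ * Matrix.diagonal (fun k => (e k : ℂ)) * M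
  have hB : B.PosSemidef := by
    refine Matrix.PosSemidef.conjTranspose_mul_mul_same (Matrix.PosSemidef.diagonal fun k => ?_) M
    simp only [e, Pi.zero_apply, Complex.zero_le_real]
    split_ifs
    · exact le_rfl
    · exact (hd k).le
  have hNdet : N.det = (∏ l, (Real.sqrt (d (r l)) : ℂ)) * (M.submatrix r id).det := by
    rw [Matrix.det_mul, Matrix.det_diagonal]
  have hN0 : N.det ≠ 0 := by
    rw [hNdet]
    refine mul_ne_zero (Finset.prod_ne_zero_iff.2 fun l _ => ?_) hr
    exact_mod_cast (Real.sqrt_pos.2 (hd _)).ne'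
  have hsum : Mᴴ * Matrix.diagonal (fun k => (d k : ℂ)) * M = Nᴴ * N + B := by
    ext i j
    have h1 : (Nᴴ * N) i j = ∑ l, star (M (r l) i) * (d (r l) : ℂ) * M (r l) j := by
      have hN : Nᴴ * N = (M.submatrix r id)ᴴ * Matrix.diagonal (fun l => (d (r l) : ℂ)) *
          M.submatrix r id := by
        rw [Matrix.conjTranspose_mul, Matrix.diagonal_conjTranspose, Matrix.mul_assoc,
          ← Matrix.mul_assoc (Matrix.diagonal _), Matrix.diagonal_mul_diagonal, ← Matrix.mul_assoc]
        congr 3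
        ext l
        simp only [Pi.star_apply, Complex.star_def, Complex.conj_ofReal]
        rw [← Complex.ofReal_mul, Real.mul_self_sqrt (hd _).le]
      rw [hN, conjTranspose_mul_diagonal_mul_apply]
      rfl
    have h2 : ∑ l, star (M (r l) i) * (d (r l) : ℂ) * M (r l) j =
        ∑ k, if k ∈ Set.range r then star (M k i) * (d k : ℂ) * M k j else 0 := by
      rw [← Finset.sum_filter, ← Finset.sum_image (s := Finset.univ) (g := r)
        (f := fun k => star (M k i) * (d k : ℂ) * M k j) (fun _ _ _ _ h => hinj h)]
      refine Finset.sum_congr ?_ fun _ _ => rfl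
      ext k; simp
    have h3 : B i j = ∑ k, star (M k i) * (e k : ℂ) * M k j :=
      conjTranspose_mul_diagonal_mul_apply _ _ _ _
    rw [Matrix.add_apply, h1, h2, h3, conjTranspose_mul_diagonal_mul_apply, ← Finset.sum_add_distrib]
    refine Finset.sum_congr rfl fun k _ => ?_
    by_cases hk : k ∈ Set.range r
    · rw [if_pos hk, show e k = 0 from if_pos hk]
      simp
    · rw [if_neg hk, show e k = d k from if_neg hk, zero_add]
  have hNu : IsUnit N.det := isUnit_iff_ne_zero.2 hN0
  have hfac : Nᴴ * N + B = Nᴴ * (1 + (N⁻¹)ᴴ * B * N⁻¹) * N := by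
    have h3 : Nᴴ * (N⁻¹)ᴴ = 1 := by
      rw [← Matrix.conjTranspose_mul, Matrix.nonsing_inv_mul _ hNu, Matrix.conjTranspose_one]
    have h4 : Nᴴ * (1 + (N⁻¹)ᴴ * B * N⁻¹) * N =
        Nᴴ * N + (Nᴴ * (N⁻¹)ᴴ) * B * (N⁻¹ * N) := by
      simp only [Matrix.mul_add, Matrix.add_mul, Matrix.mul_assoc, Matrix.mul_one]
    rw [h4, h3, Matrix.nonsing_inv_mul _ hNu, Matrix.one_mul, Matrix.mul_one]
  obtain ⟨t, ht, htd⟩ := one_le_re_det_one_add (hB.conjTranspose_mul_mul_same N⁻¹)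
  have h5 : (Mᴴ * Matrix.diagonal (fun k => (d k : ℂ)) * M).det = ((‖N.det‖ ^ 2 * t : ℝ) : ℂ) := by
    rw [hsum, hfac, Matrix.det_mul, Matrix.det_mul, htd, Matrix.det_conjTranspose, mul_right_comm,
      Complex.star_def, Complex.conj_mul']
    push_cast
    ring
  have h6 : ‖N.det‖ ^ 2 = (∏ l, d (r l)) * ‖(M.submatrix r id).det‖ ^ 2 := by
    rw [hNdet, norm_mul, mul_pow, norm_prod, ← Finset.prod_pow]
    congr 1
    refine Finset.prod_congr rfl fun l _ => ?_
    rw [Complex.norm_real, Real.norm_eq_abs, sq_abs, Real.sq_sqrt (hd _).le]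
  rw [h5, Complex.ofReal_re, ← h6]
  exact le_mul_of_one_le_right (by positivity) ht

end DetLowerBound

theorem exists_greedy_linearIndepOn {ι V : Type*} [Fintype ι] [DecidableEq ι] [AddCommGroup V]
    [Module ℂ V] (v : ι → V) (x : ι → ℝ) :
    ∃ I : Finset ι, LinearIndepOn ℂ v (I : Set ι) ∧
      ∀ i, v i ∈ Submodule.span ℂ (v '' {k | k ∈ I ∧ x i ≤ x k}) := by
  suffices h : ∀ S : Finset ι, ∃ I ⊆ S, LinearIndepOn ℂ v (I : Set ι) ∧
      ∀ i ∈ S, v i ∈ Submodule.span ℂ (v '' {k | k ∈ I ∧ x i ≤ x k}) by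
    obtain ⟨I, -, hI, h⟩ := h Finset.univ
    exact ⟨I, hI, fun i => h i (Finset.mem_univ i)⟩
  intro S
  induction S using Finset.induction_on_min_value x with
  | empty => exact ⟨∅, subset_rfl, by simp, by simp⟩
  | insert a S ha hmin ih =>
    obtain ⟨I, hIS, hI, h⟩ := ih
    by_cases hv : v a ∈ Submodule.span ℂ (v '' (I : Set ι))
    · refine ⟨I, hIS.trans (Finset.subset_insert _ _), hI, fun i hi => ?_⟩
      rcases Finset.mem_insert.1 hi with rfl | hi
      · refine Submodule.span_mono (Set.image_mono fun k hk => ?_) hv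
        exact ⟨hk, hmin k (hIS hk)⟩
      · exact h i hi
    · refine ⟨insert a I, Finset.insert_subset_insert _ hIS, ?_, fun i hi => ?_⟩
      · rw [Finset.coe_insert]
        exact hI.insert hv
      rcases Finset.mem_insert.1 hi with rfl | hi
      · exact Submodule.subset_span ⟨i, ⟨Finset.mem_insert_self _ _, le_rfl⟩, rfl⟩
      · refine Submodule.span_mono (Set.image_mono fun k hk => ?_) (h i hi)
        exact ⟨Finset.mem_insert_of_mem hk.1, hk.2⟩

theorem sum_mul_nonneg_of_superlevel_sums {ι : Type*} [Fintype ι] [DecidableEq ι] (w x : ι → ℝ)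
    (h : ∀ c, 0 ≤ ∑ k with c ≤ x k, w k) (h0 : ∑ k, w k = 0) : 0 ≤ ∑ k, w k * x k := by
  have key : ∀ S : Finset ι, ∀ m : ℝ, (∀ k ∈ S, m ≤ x k) →
      (∀ c, m < c → 0 ≤ ∑ k ∈ S with c ≤ x k, w k) → 0 ≤ ∑ k ∈ S, w k * (x k - m) := by
    intro S
    induction S using Finset.induction_on_min_value x with
    | empty => simp
    | insert a S ha hmin ih =>
      intro m hm hS
      have h1 := ih (x a) hmin fun c hc => by
        have := hS c ((hm a (Finset.mem_insert_self _ _)).trans_lt hc)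
        rwa [Finset.filter_insert, if_neg (not_le.2 hc)] at this
      have h2 : 0 ≤ (x a - m) * ∑ k ∈ insert a S, w k := by
        rcases (hm a (Finset.mem_insert_self _ _)).eq_or_lt with h3 | h3
        · simp [h3]
        · have := hS (x a) h3
          rw [Finset.filter_true_of_mem] at this
          · exact mul_nonneg (sub_nonneg.2 h3.le) this
          · intro k hk
            rcases Finset.mem_insert.1 hk with rfl | hk
            · exact le_rfl
            · exact hmin k hk
      have h4 : ∑ k ∈ insert a S, w k * (x k - m) =
          ∑ k ∈ S, w k * (x k - x a) + (x a - m) * ∑ k ∈ insert a S, w k := by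
        rw [Finset.sum_insert ha, Finset.sum_insert ha, mul_add, Finset.mul_sum, add_left_comm,
          ← Finset.sum_add_distrib]
        congr 1
        · ring
        · exact Finset.sum_congr rfl fun k _ => by ring
      rw [h4]
      exact add_nonneg h1 h2
  obtain ⟨m, hm⟩ : ∃ m : ℝ, ∀ k, m ≤ x k := by
    obtain ⟨m, hm⟩ := (Set.finite_range x).bddBelow
    exact ⟨m, fun k => hm ⟨k, rfl⟩⟩
  have := key Finset.univ m (fun k _ => hm k) fun c _ => h c
  simpa only [mul_sub, Finset.sum_sub_distrib, ← Finset.sum_mul, h0, zero_mul, sub_zero] using this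

theorem isCompact_unitary_matrices (ι : Type*) [Fintype ι] [DecidableEq ι] :
    IsCompact {U : Matrix ι ι ℂ | Uᴴ * U = 1} := by
  have hK : IsCompact (Set.univ.pi fun _ : ι => Set.univ.pi fun _ : ι =>
      Metric.closedBall (0 : ℂ) 1) :=
    isCompact_univ_pi fun _ => isCompact_univ_pi fun _ => isCompact_closedBall _ _
  refine hK.of_isClosed_subset (isClosed_eq (by fun_prop) continuous_const) fun U hU => ?_
  simp only [Set.mem_pi, Set.mem_univ, forall_const, mem_closedBall_zero_iff]
  intro i j
  exact entry_norm_bound_of_unitary (Matrix.mem_unitaryGroup_iff'.2 hU) i j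

section LogDet

open scoped ComplexOrder

variable {ι Λ : Type*} [Fintype ι] [DecidableEq ι] [Fintype Λ]

theorem rank_coordProj (s : Finset ι) : (coordProj ℂ s).rank = s.card := by
  rw [coordProj, Matrix.rank_diagonal, Fintype.card_subtype]
  congr 1
  ext i
  simp

theorem exists_greedy_frame (A : Matrix ι ι ℂ) (hA : IsUnit A.det) (s : Finset ι) (x : ι → ℝ) :
    ∃ r : s → ι, (A.submatrix r Subtype.val).det ≠ 0 ∧
      ∀ c, (coordProj ℂ {k | c ≤ x k} * A * coordProj ℂ s).rank ≤
        Finset.card {l : s | c ≤ x (r l)} := by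
  obtain ⟨I, hI, hspan⟩ := exists_greedy_linearIndepOn (A * coordProj ℂ s).row x
  have hcard : I.card = s.card := by
    have h1 : Set.range (fun k : I => (A * coordProj ℂ s).row k) =
        (A * coordProj ℂ s).row '' (I : Set ι) := by
      ext y; simp
    have h2 : Submodule.span ℂ ((A * coordProj ℂ s).row '' (I : Set ι)) =
        Submodule.span ℂ (Set.range (A * coordProj ℂ s).row) := by
      refine le_antisymm (Submodule.span_mono (Set.image_subset_range _ _))
        (Submodule.span_le.2 ?_)
      rintro _ ⟨i, rfl⟩
      exact Submodule.span_mono (Set.image_mono fun k hk => hk.1) (hspan i)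
    have h3 := finrank_span_eq_card (R := ℂ) (b := fun k : I => (A * coordProj ℂ s).row k) hI
    rw [h1, h2, ← Matrix.rank_eq_finrank_span_row, Matrix.rank_mul_eq_right_of_isUnit_det _ _ hA,
      rank_coordProj] at h3
    simpa using h3.symm
  let e : s ≃ I := (Finset.equivOfCardEq hcard).symm
  refine ⟨fun l => e l, ?_, fun c => ?_⟩
  · have hli : LinearIndependent ℂ (fun l : s => (A * coordProj ℂ s).row (e l)) :=
      hI.comp e e.injective
    let Q : Matrix s ι ℂ := Matrix.of fun l i => if (l : ι) = i then 1 else 0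
    have hQ : (fun l : s => (A * coordProj ℂ s).row (e l)) =
        Q.vecMulLinear ∘ (A.submatrix (fun l => (e l : ι)) (Subtype.val : s → ι)).row := by
      ext l i
      simp only [Function.comp, Matrix.vecMulLinear_apply, Matrix.vecMul, dotProduct, Q,
        Matrix.of_apply, Matrix.row_apply, Matrix.submatrix_apply, coordProj,
        Matrix.mul_diagonal, mul_ite, mul_one, mul_zero]
      by_cases hi : i ∈ s
      · rw [if_pos hi, Finset.sum_eq_single ⟨i, hi⟩]
        · simp
        · intro k _ hk
          rw [if_neg fun h => hk (Subtype.ext h)]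
        · simp
      · rw [if_neg hi, Finset.sum_eq_zero]
        intro k _
        rw [if_neg fun h : (k : ι) = i => hi (h ▸ k.2)]
    rw [hQ] at hli
    have := Matrix.linearIndependent_rows_iff_isUnit.1 (LinearIndependent.of_comp _ hli)
    exact ((Matrix.isUnit_iff_isUnit_det _).1 this).ne_zero
  · rw [Matrix.rank_eq_finrank_span_row]
    have h1 : Submodule.span ℂ (Set.range (coordProj ℂ {k | c ≤ x k} * A * coordProj ℂ s).row) ≤
        Submodule.span ℂ ((I.filter fun k => c ≤ x k).image (A * coordProj ℂ s).row : Set _) := by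
      rw [Submodule.span_le]
      rintro _ ⟨k, rfl⟩
      have h2 : (coordProj ℂ {k | c ≤ x k} * A * coordProj ℂ s).row k =
          if c ≤ x k then (A * coordProj ℂ s).row k else 0 := by
        ext i
        rw [Matrix.mul_assoc, coordProj, Matrix.row_apply, Matrix.diagonal_mul]
        split_ifs <;> simp_all
      rw [h2]
      split_ifs with hk
      · refine Submodule.span_mono ?_ (hspan k)
        rintro _ ⟨i, ⟨hi, hki⟩, rfl⟩
        exact Finset.mem_coe.2 (Finset.mem_image_of_mem _
          (Finset.mem_filter.2 ⟨hi, hk.trans hki⟩))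
      · exact Submodule.zero_mem _
    refine (Submodule.finrank_mono h1).trans ((finrank_span_finset_le_card _).trans
      (Finset.card_image_le.trans ?_))
    refine Finset.card_le_card_of_surjOn (fun l => (e l : ι)) ?_
    intro k hk
    obtain ⟨hk1, hk2⟩ := Finset.mem_filter.1 (Finset.mem_coe.1 hk)
    refine ⟨e.symm ⟨k, hk1⟩, ?_, by simp⟩
    simpa using hk2

/-- The determinant of the principal block of `H` on the coordinates in `s`. -/
noncomputable def principalMinor (s : Finset ι) (H : Matrix ι ι ℂ) : ℂ :=
  (H.submatrix (Subtype.val : s → ι) Subtype.val).det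

/-- The Brascamp-Lieb type functional `∑ⱼ aⱼ log det ((gⱼᴴ H gⱼ)|sⱼ) - b log det H`. -/
noncomputable def logDetFunctional (s : Λ → Finset ι) (a : Λ → ℝ) (b : ℝ) (g : Λ → Matrix ι ι ℂ)
    (H : Matrix ι ι ℂ) : ℝ :=
  ∑ j, a j * Real.log (principalMinor (s j) ((g j)ᴴ * H * g j)).re - b * Real.log H.det.re

theorem sum_greedy_weights_nonneg {s : Λ → Finset ι} {a : Λ → ℝ} {b : ℝ} {g : Λ → Matrix ι ι ℂ}
    (ha : ∀ j, 0 ≤ a j) (hrank : RankBound s a b g)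
    (hdim : b * Fintype.card ι = ∑ j, a j * (s j).card) {U : Matrix ι ι ℂ} (hU : IsUnit U.det)
    (x : ι → ℝ) (r : ∀ j, s j → ι)
    (hr : ∀ j c, (coordProj ℂ {k | c ≤ x k} * (U * g j) * coordProj ℂ (s j)).rank ≤
        Finset.card {l : s j | c ≤ x (r j l)}) :
    b * ∑ k, x k ≤ ∑ j, a j * ∑ l, x (r j l) := by
  let w : ι → ℝ := fun k => ∑ j, a j * (Finset.card {l : s j | r j l = k} : ℝ) - b
  have hfib : ∀ j (f : ι → ℝ),
      ∑ k, (Finset.card {l : s j | r j l = k} : ℝ) * f k = ∑ l, f (r j l) := by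
    intro j f
    rw [← Finset.sum_fiberwise Finset.univ (r j) (fun l => f (r j l))]
    refine Finset.sum_congr rfl fun k _ => ?_
    rw [Finset.sum_congr rfl (g := fun _ => f k)
      (fun l hl => by rw [(Finset.mem_filter.1 hl).2])]
    simp
  have hw : ∀ f : ι → ℝ, ∑ k, w k * f k = ∑ j, a j * ∑ l, f (r j l) - b * ∑ k, f k := by
    intro f
    simp only [w, sub_mul, Finset.sum_sub_distrib, Finset.sum_mul, Finset.mul_sum]
    rw [Finset.sum_comm]
    congr 1
    refine Finset.sum_congr rfl fun j _ => ?_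
    rw [← Finset.mul_sum, ← hfib j f, Finset.mul_sum]
    exact Finset.sum_congr rfl fun k _ => mul_assoc _ _ _
  have key := sum_mul_nonneg_of_superlevel_sums w x ?_ ?_
  · rw [hw] at key
    linarith
  · intro c
    have h1 : ∑ k with c ≤ x k, w k = ∑ k, w k * (if c ≤ x k then 1 else 0) := by
      simp [Finset.sum_filter]
    rw [h1, hw]
    have h2 := hrank (coordProj ℂ {k | c ≤ x k} * U)
    have h3 : (coordProj ℂ {k | c ≤ x k} * U).rank = Finset.card {k | c ≤ x k} := by
      rw [Matrix.rank_mul_eq_left_of_isUnit_det _ _ hU, rank_coordProj]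
    have h4 : ∀ j, ((coordProj ℂ {k | c ≤ x k} * U * g j * coordProj ℂ (s j)).rank : ℝ) ≤
        ∑ l : s j, if c ≤ x (r j l) then 1 else 0 := by
      intro j
      rw [Finset.sum_boole, Matrix.mul_assoc (coordProj ℂ _) U]
      exact_mod_cast hr j c
    have h5 := h2.trans (Finset.sum_le_sum fun j _ => mul_le_mul_of_nonneg_left (h4 j) (ha j))
    rw [h3] at h5
    rw [Finset.sum_boole]
    linarith
  · have := hw fun _ => 1
    simp only [mul_one, Finset.sum_const, Finset.card_univ, nsmul_eq_mul, Fintype.card_coe] at this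
    rw [this, hdim]
    simp

theorem logDetFunctional_conj_diagonal (s : Λ → Finset ι) (a : Λ → ℝ) (b : ℝ)
    (g : Λ → Matrix ι ι ℂ) {U : Matrix ι ι ℂ} (hU : U * Uᴴ = 1) {d : ι → ℝ} (hd : ∀ k, 0 < d k) :
    logDetFunctional s a b g (U * Matrix.diagonal (fun k => (d k : ℂ)) * Uᴴ) =
      ∑ j, a j * Real.log ((((Uᴴ * g j).submatrix id (Subtype.val : s j → ι))ᴴ *
        Matrix.diagonal (fun k => (d k : ℂ)) *
          (Uᴴ * g j).submatrix id (Subtype.val : s j → ι)).det).re - b * ∑ k, Real.log (d k) := by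
  rw [logDetFunctional]
  congr 1
  · refine Finset.sum_congr rfl fun j _ => ?_
    rw [principalMinor]
    congr 4
    have : (g j)ᴴ * (U * Matrix.diagonal (fun k => (d k : ℂ)) * Uᴴ) * g j =
        (Uᴴ * g j)ᴴ * Matrix.diagonal (fun k => (d k : ℂ)) * (Uᴴ * g j) := by
      simp only [Matrix.conjTranspose_mul, Matrix.conjTranspose_conjTranspose, Matrix.mul_assoc]
    rw [this]
    rfl
  · rw [Matrix.det_mul, Matrix.det_mul, mul_right_comm, ← Matrix.det_mul, hU, Matrix.det_one,
      one_mul, Matrix.det_diagonal, ← Complex.ofReal_prod, Complex.ofReal_re, Real.log_prod]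
    exact fun k _ => (hd k).ne'

theorem RankBound.exists_logDet_lower_bound {s : Λ → Finset ι} {a : Λ → ℝ} {b : ℝ}
    {g : Λ → Matrix ι ι ℂ} (ha : ∀ j, 0 ≤ a j) (hg : ∀ j, IsUnit (g j).det)
    (hdim : b * Fintype.card ι = ∑ j, a j * (s j).card) (hrank : RankBound s a b g) :
    ∃ C : ℝ, ∀ H : Matrix ι ι ℂ, H.PosDef → C ≤ logDetFunctional s a b g H := by
  suffices h : ∃ C : ℝ, ∀ U ∈ {U : Matrix ι ι ℂ | Uᴴ * U = 1}, ∀ d : ι → ℝ, (∀ k, 0 < d k) →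
      C ≤ logDetFunctional s a b g (U * Matrix.diagonal (fun k => (d k : ℂ)) * Uᴴ) by
    obtain ⟨C, hC⟩ := h
    refine ⟨C, fun H hH => ?_⟩
    obtain ⟨U, hU, -, hd⟩ := hH.isHermitian.exists_unitary_diagonal
    rw [hd]
    exact hC U hU _ hH.eigenvalues_pos
  refine (isCompact_unitary_matrices ι).induction_on (p := fun K => ∃ C : ℝ, ∀ U ∈ K,
    ∀ d : ι → ℝ, (∀ k, 0 < d k) →
      C ≤ logDetFunctional s a b g (U * Matrix.diagonal (fun k => (d k : ℂ)) * Uᴴ)) ?_ ?_ ?_ ?_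
  · exact ⟨0, by simp⟩
  · rintro K K' hK ⟨C, hC⟩
    exact ⟨C, fun U hU => hC U (hK hU)⟩
  · rintro K K' ⟨C, hC⟩ ⟨C', hC'⟩
    refine ⟨min C C', fun U hU d hd => ?_⟩
    rcases hU with hU | hU
    · exact (min_le_left _ _).trans (hC U hU d hd)
    · exact (min_le_right _ _).trans (hC' U hU d hd)
  intro U₀ hU₀
  let m : (Σ j : Λ, s j → ι) → Matrix ι ι ℂ → ℝ := fun t U =>
    ‖((Uᴴ * g t.1).submatrix t.2 (Subtype.val : s t.1 → ι)).det‖ ^ 2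
  have hmc : ∀ t, Continuous (m t) := fun t => by
    refine (Continuous.norm (Continuous.matrix_det ?_)).pow 2
    exact Continuous.matrix_submatrix (by fun_prop) _ _
  obtain ⟨δ, hδ0, hδ⟩ : ∃ δ : ℝ, 0 < δ ∧ ∀ t, m t U₀ ≠ 0 → δ < m t U₀ := by
    have hfin : ∀ T : Finset (Σ j : Λ, s j → ι), ∃ δ : ℝ, 0 < δ ∧
        ∀ t ∈ T, m t U₀ ≠ 0 → δ < m t U₀ := by
      intro T
      classical
      induction T using Finset.induction_on with
      | empty => exact ⟨1, one_pos, by simp⟩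
      | insert t T _ ih =>
        obtain ⟨δ, hδ0, hδ⟩ := ih
        by_cases ht : m t U₀ = 0
        · refine ⟨δ, hδ0, fun t' ht' h => ?_⟩
          rcases Finset.mem_insert.1 ht' with rfl | ht'
          · exact absurd ht h
          · exact hδ t' ht' h
        · have hpos : 0 < m t U₀ := lt_of_le_of_ne (by positivity) (Ne.symm ht)
          refine ⟨min δ (m t U₀ / 2), by positivity, fun t' ht' h => ?_⟩
          rcases Finset.mem_insert.1 ht' with rfl | ht'
          · exact (min_le_right _ _).trans_lt (by linarith)
          · exact (min_le_left _ _).trans_lt (hδ t' ht' h)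
    classical
    obtain ⟨δ, h0, h⟩ := hfin Finset.univ
    exact ⟨δ, h0, fun t => h t (Finset.mem_univ t)⟩
  refine ⟨{U | Uᴴ * U = 1} ∩ {U | ∀ t, m t U₀ ≠ 0 → δ < m t U}, ?_,
    ∑ j, a j * Real.log δ, ?_⟩
  · refine Filter.inter_mem self_mem_nhdsWithin (mem_nhdsWithin_of_mem_nhds ?_)
    refine (Filter.eventually_all (l := nhds U₀)).2 fun t => ?_
    by_cases ht : m t U₀ = 0
    · exact Filter.Eventually.of_forall fun U h => absurd ht h
    · filter_upwards [(hmc t).continuousAt.eventually (lt_mem_nhds (hδ t ht))] with U hU _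
      exact hU
  rintro U ⟨hU, hUm⟩ d hd
  have hU' : U * Uᴴ = 1 := mul_eq_one_comm.1 hU
  have hU₀' : IsUnit (U₀ᴴ).det := by
    have : (U₀ᴴ * U₀).det = 1 := by rw [hU₀, Matrix.det_one]
    rw [Matrix.det_mul] at this
    exact IsUnit.of_mul_eq_one _ this
  have hframe := fun j => exists_greedy_frame (U₀ᴴ * g j)
    (by rw [Matrix.det_mul]; exact hU₀'.mul (hg j)) (s j) (fun k => Real.log (d k))
  choose r hr hr' using hframe
  have hsum := sum_greedy_weights_nonneg ha hrank hdim hU₀' (fun k => Real.log (d k)) r hr'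
  rw [logDetFunctional_conj_diagonal s a b g hU' hd]
  have hterm : ∀ j, Real.log δ + ∑ l, Real.log (d (r j l)) ≤
      Real.log ((((Uᴴ * g j).submatrix id (Subtype.val : s j → ι))ᴴ *
        Matrix.diagonal (fun k => (d k : ℂ)) *
          (Uᴴ * g j).submatrix id (Subtype.val : s j → ι)).det).re := by
    intro j
    have h1 : δ < ‖((Uᴴ * g j).submatrix (r j) (Subtype.val : s j → ι)).det‖ ^ 2 :=
      hUm ⟨j, r j⟩ (pow_ne_zero 2 (norm_ne_zero_iff.2 (hr j)))
    have h2 : (((Uᴴ * g j).submatrix id (Subtype.val : s j → ι)).submatrix (r j) id).det ≠ 0 := by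
      intro h0
      rw [show (Uᴴ * g j).submatrix (r j) (Subtype.val : s j → ι) =
        ((Uᴴ * g j).submatrix id (Subtype.val : s j → ι)).submatrix (r j) id from rfl, h0] at h1
      simp at h1
      linarith
    have h3 := prod_mul_normSq_det_submatrix_le _ hd (r j) h2
    have h4 : 0 < ∏ l, d (r j l) := Finset.prod_pos fun l _ => hd _
    have h5 : δ * ∏ l, d (r j l) ≤ _ :=
      (mul_comm δ _).le.trans ((mul_le_mul_of_nonneg_left h1.le h4.le).trans h3)
    rw [← Real.log_prod (fun l _ => (hd (r j l)).ne'), ← Real.log_mul hδ0.ne' h4.ne']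
    exact Real.log_le_log (by positivity) h5
  have := Finset.sum_le_sum fun j (_ : j ∈ Finset.univ) =>
    mul_le_mul_of_nonneg_left (hterm j) (ha j)
  simp only [mul_add, Finset.sum_add_distrib] at this
  linarith

end LogDet

section PrincipalMinor

open scoped ComplexOrder

variable {ι : Type*} [DecidableEq ι]

theorem principalMinor_eq_det_mul_coordProj_add [Fintype ι] (s : Finset ι) (M : Matrix ι ι ℂ) :
    principalMinor s M = (M * coordProj ℂ s + coordProj ℂ sᶜ).det := by
  rw [Matrix.twoBlockTriangular_det' _ (· ∈ s)]
  · have h1 : (M * coordProj ℂ s + coordProj ℂ sᶜ).toSquareBlockProp (fun i => ¬ i ∈ s) = 1 := by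
      ext i j
      rw [Matrix.toSquareBlockProp_def, Matrix.of_apply, Matrix.add_apply, coordProj,
        Matrix.mul_diagonal, if_neg j.2, coordProj, Matrix.diagonal_apply, Matrix.one_apply]
      simp [Subtype.ext_iff, i.2]
    have h2 : (M * coordProj ℂ s + coordProj ℂ sᶜ).toSquareBlockProp (fun i => i ∈ s) =
        M.submatrix (Subtype.val : s → ι) Subtype.val := by
      ext i j
      rw [Matrix.toSquareBlockProp_def, Matrix.of_apply, Matrix.add_apply, coordProj,
        Matrix.mul_diagonal, if_pos j.2, coordProj, Matrix.diagonal_apply]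
      simp [i.2]
    rw [h1, h2, Matrix.det_one, mul_one, principalMinor]
    convert rfl
  · intro i hi j hj
    rw [Matrix.add_apply, coordProj, Matrix.mul_diagonal, if_neg hj, coordProj,
      Matrix.diagonal_apply, if_neg (fun h : i = j => hj (h ▸ hi))]
    simp

/-- Jacobi's identity for complementary principal minors. -/
theorem principalMinor_eq_det_mul_compl [Fintype ι] (s : Finset ι) {M N : Matrix ι ι ℂ} (h : M * N = 1) :
    principalMinor s M = M.det * principalMinor sᶜ N := by
  rw [principalMinor_eq_det_mul_coordProj_add, principalMinor_eq_det_mul_coordProj_add,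
    ← Matrix.det_mul, Matrix.mul_add, ← Matrix.mul_assoc, h, Matrix.one_mul, compl_compl, add_comm]

theorem principalMinor_map {β : Type*} [DecidableEq β] (f : β ↪ ι) (s : Finset β) (M : Matrix ι ι ℂ) :
    principalMinor (s.map f) M = principalMinor s (M.submatrix f f) := by
  let e : s ≃ s.map f := Equiv.ofBijective (fun k => ⟨f k, Finset.mem_map_of_mem f k.2⟩)
    ⟨fun k l h => Subtype.ext (f.injective (Subtype.ext_iff.1 h)), by
      rintro ⟨y, hy⟩
      obtain ⟨k, hk, rfl⟩ := Finset.mem_map.1 hy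
      exact ⟨⟨k, hk⟩, rfl⟩⟩
  rw [principalMinor, ← Matrix.det_submatrix_equiv_self e]
  rfl

theorem principalMinor_pos {M : Matrix ι ι ℂ} (hM : M.PosDef) (s : Finset ι) :
    0 < principalMinor s M :=
  (hM.submatrix Subtype.val_injective).det_pos

theorem log_principalMinor_le [Fintype ι] {M : Matrix ι ι ℂ} (hM : M.PosDef) (s : Finset ι) :
    Real.log (principalMinor s M).re ≤ ((M - 1) * coordProj ℂ s).trace.re := by
  have hs : (M.submatrix (Subtype.val : s → ι) Subtype.val).PosDef :=
    hM.submatrix Subtype.val_injective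
  have h1 : ((M - 1) * coordProj ℂ s).trace =
      (M.submatrix (Subtype.val : s → ι) Subtype.val).trace - s.card := by
    rw [Matrix.trace, Matrix.trace]
    have : ∀ i, ((M - 1) * coordProj ℂ s).diag i = if i ∈ s then M i i - 1 else 0 := by
      intro i
      rw [Matrix.diag_apply, coordProj, Matrix.mul_diagonal]
      simp
    simp only [this]
    rw [← Finset.sum_filter, Finset.filter_mem_eq_inter, Finset.univ_inter,
      Finset.sum_sub_distrib]
    simp only [Matrix.diag_apply, Matrix.submatrix_apply, Finset.sum_const, nsmul_eq_mul, mul_one]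
    rw [Finset.sum_coe_sort s fun i => M i i]
  have h2 := hs.isHermitian.det_eq_prod_eigenvalues
  have h3 := hs.isHermitian.trace_eq_sum_eigenvalues
  rw [h1, h3, principalMinor, h2]
  simp only [Complex.coe_algebraMap, ← Complex.ofReal_prod, ← Complex.ofReal_sum,
    Complex.ofReal_re, Complex.sub_re, Complex.natCast_re]
  rw [Real.log_prod fun i _ => (hs.eigenvalues_pos i).ne']
  have : ∀ i ∈ Finset.univ, Real.log (hs.isHermitian.eigenvalues i) ≤
      hs.isHermitian.eigenvalues i - 1 :=
    fun i _ => Real.log_le_sub_one_of_pos (hs.eigenvalues_pos i)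
  refine (Finset.sum_le_sum this).trans ?_
  simp

end PrincipalMinor

section Triangular

open scoped ComplexOrder

theorem exists_upperTriangular_conj_eq_one {β : Type*} [Fintype β] [LinearOrder β]
    [LocallyFiniteOrderBot β] [WellFoundedLT β] {P : Matrix β β ℂ} (hP : P.PosDef) :
    ∃ T : Matrix β β ℂ, (∀ i j, j < i → T i j = 0) ∧ Tᴴ * P * T = 1 := by
  let S : Matrix β β ℂ := LDL.lowerInv hP
  have hd : LDL.diag hP = S * P * Sᴴ := LDL.diag_eq_lowerInv_conj hP
  have hdet : IsUnit S := @isUnit_of_invertible _ _ S (LDL.invertibleLowerInv hP)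
  have hpd : (LDL.diag hP).PosDef := by
    rw [hd]
    exact hP.mul_mul_conjTranspose_same (Matrix.vecMul_injective_of_isUnit hdet)
  have hpos : ∀ i, 0 < LDL.diagEntries hP i := fun i => by
    have := Matrix.PosDef.diag_pos hpd (i := i)
    rwa [LDL.diag, Matrix.diagonal_apply_eq] at this
  let D : Matrix β β ℂ := Matrix.diagonal fun i =>
    ((Real.sqrt (LDL.diagEntries hP i).re)⁻¹ : ℂ)
  have hDD : D * LDL.diag hP * D = 1 := by
    rw [LDL.diag, Matrix.diagonal_mul_diagonal, Matrix.diagonal_mul_diagonal,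
      ← Matrix.diagonal_one]
    congr 1
    funext i
    obtain ⟨h1, h2⟩ := Complex.pos_iff.1 (hpos i)
    have h3 : LDL.diagEntries hP i = ((LDL.diagEntries hP i).re : ℂ) :=
      Complex.ext rfl (by simpa using h2.symm)
    have h4 : (Real.sqrt (LDL.diagEntries hP i).re : ℂ) ≠ 0 :=
      Complex.ofReal_ne_zero.2 (Real.sqrt_pos.2 h1).ne'
    have h5 : LDL.diagEntries hP i = (Real.sqrt (LDL.diagEntries hP i).re : ℂ) *
        (Real.sqrt (LDL.diagEntries hP i).re : ℂ) := by
      rw [← Complex.ofReal_mul, Real.mul_self_sqrt h1.le]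
      exact h3
    rw [h5]
    simp only [← Complex.ofReal_mul, Complex.ofReal_re, Real.sqrt_mul_self (Real.sqrt_nonneg _)]
    rw [Complex.ofReal_mul]
    field_simp
  have hDH : Dᴴ = D := by
    rw [Matrix.diagonal_conjTranspose]
    congr 1
    funext i
    simp
  refine ⟨Sᴴ * D, fun i j hij => ?_, ?_⟩
  · have h0 : S j i = 0 := LDL.lowerInv_triangular hP hij
    rw [Matrix.mul_diagonal, Matrix.conjTranspose_apply, h0]
    simp
  · rw [Matrix.conjTranspose_mul, Matrix.conjTranspose_conjTranspose, hDH, ← hDD, hd]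
    simp only [Matrix.mul_assoc]

theorem principalMinor_Iic_conj {β : Type*} [Fintype β] [LinearOrder β]
    [LocallyFiniteOrderBot β] {T : Matrix β β ℂ} (hT : ∀ i j, j < i → T i j = 0)
    (X : Matrix β β ℂ) (i : β) :
    principalMinor (Finset.Iic i) (Tᴴ * X * T) =
      principalMinor (Finset.Iic i) (Tᴴ * T) * principalMinor (Finset.Iic i) X := by
  have key : ∀ X : Matrix β β ℂ, (Tᴴ * X * T).submatrix
      (Subtype.val : Finset.Iic i → β) (Subtype.val : Finset.Iic i → β) =
      (T.submatrix (Subtype.val : Finset.Iic i → β) (Subtype.val : Finset.Iic i → β))ᴴ *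
        X.submatrix (Subtype.val : Finset.Iic i → β) (Subtype.val : Finset.Iic i → β) *
          T.submatrix (Subtype.val : Finset.Iic i → β) (Subtype.val : Finset.Iic i → β) := by
    intro X
    let S : Matrix β (Finset.Iic i) ℂ := 
      (1 : Matrix β β ℂ).submatrix id (Subtype.val : Finset.Iic i → β)
    have hS : ∀ Y : Matrix β β ℂ, Y.submatrix (Subtype.val : Finset.Iic i → β) (Subtype.val : Finset.Iic i → β) =
        Sᴴ * Y * S := by
      intro Y
      ext k l
      simp [S, Matrix.mul_apply, Matrix.one_apply]
    have hTS : T * S = S * T.submatrix (Subtype.val : Finset.Iic i → β) (Subtype.val : Finset.Iic i → β) := by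
      ext k l
      have h1 : (T * S) k l = T k l := by simp [S, Matrix.mul_apply, Matrix.one_apply]
      rw [h1, Matrix.mul_apply]
      simp only [S, Matrix.submatrix_apply, Matrix.one_apply, id, ite_mul, one_mul, zero_mul]
      by_cases hk : k ≤ i
      · rw [Finset.sum_eq_single ⟨k, Finset.mem_Iic.2 hk⟩]
        · simp
        · intro m _ hm
          rw [if_neg fun h => hm (Subtype.ext h.symm)]
        · simp
      · rw [hT k l ((Finset.mem_Iic.1 l.2).trans_lt (not_le.1 hk)), Finset.sum_eq_zero]
        intro m _
        rw [if_neg]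
        rintro rfl
        exact hk (Finset.mem_Iic.1 m.2)
    have hTS' : Sᴴ * Tᴴ = (T.submatrix (Subtype.val : Finset.Iic i → β) (Subtype.val : Finset.Iic i → β))ᴴ * Sᴴ := by
      rw [← Matrix.conjTranspose_mul, hTS, Matrix.conjTranspose_mul]
    calc _ = (Sᴴ * Tᴴ) * X * (T * S) := by rw [hS]; simp only [Matrix.mul_assoc]
      _ = _ := by rw [hTS, hTS', hS X]; simp only [Matrix.mul_assoc]
  have h1 := key 1
  rw [Matrix.mul_one, Matrix.submatrix_one _ Subtype.val_injective, Matrix.mul_one] at h1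
  rw [principalMinor, principalMinor, principalMinor, h1, key, Matrix.det_mul, Matrix.det_mul,
    Matrix.det_mul]
  ring

end Triangular

section Frames

open scoped ComplexOrder

variable {n β : Type*} [Fintype n] [DecidableEq n] [Fintype β] [LinearOrder β]

/-- Orthonormal frames spanning a subspace isotropic for the form `J`. -/
def isotropicFrames (J : Matrix n n ℂ) (β : Type*) [Fintype β] [LinearOrder β] :
    Set (Matrix n β ℂ) :=
  {F | Fᴴ * F = 1 ∧ Fᴴ * J * F = 0}

theorem isCompact_isotropicFrames (J : Matrix n n ℂ) : IsCompact (isotropicFrames J β) := by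
  have hK : IsCompact (Set.univ.pi fun _ : n => Set.univ.pi fun _ : β =>
      Metric.closedBall (0 : ℂ) 1) :=
    isCompact_univ_pi fun _ => isCompact_univ_pi fun _ => isCompact_closedBall _ _
  refine hK.of_isClosed_subset ((isClosed_eq (by fun_prop) continuous_const).inter
    (isClosed_eq (by fun_prop) continuous_const)) fun (F : Matrix n β ℂ) hF => ?_
  refine Set.mem_univ_pi.2 fun i => Set.mem_univ_pi.2 fun j => mem_closedBall_zero_iff.2 ?_
  have h1 : ∑ k, ‖F k j‖ ^ 2 = 1 := by
    have := congr_fun (congr_fun hF.1 j) j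
    rw [Matrix.mul_apply, Matrix.one_apply_eq] at this
    simp only [Matrix.conjTranspose_apply, RCLike.star_def, Complex.conj_mul'] at this
    exact_mod_cast this
  have h2 : ‖F i j‖ ^ 2 ≤ 1 :=
    h1 ▸ Finset.single_le_sum (f := fun k => ‖F k j‖ ^ 2) (fun k _ => by positivity)
      (Finset.mem_univ i)
  nlinarith [norm_nonneg (F i j)]

/-- An isometry of the form `J` maps a frame to an injective matrix. -/
theorem posDef_frame_gram {J : Matrix n n ℂ} (hJ : J * J = 1) {F : Matrix n β ℂ}
    (hF : Fᴴ * F = 1) {e : Matrix n n ℂ} (he : eᴴ * J * e = J) :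
    (Fᴴ * (eᴴ * e) * F).PosDef := by
  have h : (Fᴴ * J * eᴴ * J) * (e * F) = 1 := by
    calc _ = Fᴴ * J * (eᴴ * J * e) * F := by simp only [Matrix.mul_assoc]
      _ = 1 := by rw [he, Matrix.mul_assoc Fᴴ, hJ, Matrix.mul_one, hF]
  have h2 : Fᴴ * (eᴴ * e) * F = (e * F)ᴴ * (e * F) := by
    rw [Matrix.conjTranspose_mul]; simp only [Matrix.mul_assoc]
  rw [h2]
  refine Matrix.PosDef.conjTranspose_mul_self _ fun x y hxy => ?_
  have := congr_arg (fun z => (Fᴴ * J * eᴴ * J) *ᵥ z) hxy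
  simpa only [Matrix.mulVec_mulVec, h, Matrix.one_mulVec] using this

variable [LocallyFiniteOrderBot β]

theorem exists_isotropicFrame_transform {J : Matrix n n ℂ} (hJ : J * J = 1)
    {F : Matrix n β ℂ} (hF : F ∈ isotropicFrames J β) {h : Matrix n n ℂ} (hh : hᴴ * J * h = J) :
    ∃ F' ∈ isotropicFrames J β, ∀ (e : Matrix n n ℂ) (i : β),
      principalMinor (Finset.Iic i) (F'ᴴ * (eᴴ * e) * F') *
        principalMinor (Finset.Iic i) (Fᴴ * (hᴴ * h) * F) =
          principalMinor (Finset.Iic i) (Fᴴ * ((e * h)ᴴ * (e * h)) * F) := by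
  obtain ⟨T, hT, hT1⟩ := exists_upperTriangular_conj_eq_one (posDef_frame_gram hJ hF.1 hh)
  refine ⟨h * F * T, ⟨?_, ?_⟩, fun e i => ?_⟩
  · rw [← hT1]
    simp only [Matrix.conjTranspose_mul, Matrix.mul_assoc]
  · calc _ = Tᴴ * (Fᴴ * (hᴴ * J * h) * F) * T := by
          simp only [Matrix.conjTranspose_mul, Matrix.mul_assoc]
      _ = 0 := by rw [hh, hF.2, Matrix.mul_zero, Matrix.zero_mul]
  · have h1 := principalMinor_Iic_conj hT (Fᴴ * (hᴴ * h) * F) i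
    have h2 := principalMinor_Iic_conj hT (Fᴴ * ((e * h)ᴴ * (e * h)) * F) i
    have h3 : (h * F * T)ᴴ * (eᴴ * e) * (h * F * T) =
        Tᴴ * (Fᴴ * ((e * h)ᴴ * (e * h)) * F) * T := by
      simp only [Matrix.conjTranspose_mul, Matrix.mul_assoc]
    rw [hT1, principalMinor, Matrix.submatrix_one _ Subtype.val_injective, Matrix.det_one] at h1
    rw [h3, h2, mul_right_comm, ← h1, one_mul]

variable {K : Type*} [Fintype K]

/-- The weighted sum of the logarithms of the leading principal minors of the matrices
`(F k)ᴴ * H * F k`. -/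
noncomputable def frameFunctional (c : K → β → ℝ) (F : K → Matrix n β ℂ) (H : Matrix n n ℂ) : ℝ :=
  ∑ k, ∑ i, c k i * Real.log (principalMinor (Finset.Iic i) ((F k)ᴴ * H * F k)).re

/-- The sum of the weighted orthogonal projections to the flags spanned by the frames `F k`. -/
noncomputable def frameMoment (c : K → β → ℝ) (F : K → Matrix n β ℂ) : Matrix n n ℂ :=
  ∑ k, ∑ i, (c k i : ℂ) • (F k * coordProj ℂ (Finset.Iic i) * (F k)ᴴ)

theorem frameFunctional_le {J : Matrix n n ℂ} (hJ : J * J = 1) {c : K → β → ℝ}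
    (hc : ∀ k i, 0 ≤ c k i) {F : K → Matrix n β ℂ} (hF : ∀ k, F k ∈ isotropicFrames J β)
    {e : Matrix n n ℂ} (he : eᴴ * J * e = J) :
    frameFunctional c F (eᴴ * e) ≤ ((eᴴ * e - 1) * frameMoment c F).trace.re := by
  rw [frameMoment, Matrix.mul_sum, Matrix.trace_sum, Complex.re_sum, frameFunctional]
  refine Finset.sum_le_sum fun k _ => ?_
  rw [Matrix.mul_sum, Matrix.trace_sum, Complex.re_sum]
  refine Finset.sum_le_sum fun i _ => ?_
  rw [Matrix.mul_smul, Matrix.trace_smul, smul_eq_mul, Complex.re_ofReal_mul]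
  refine mul_le_mul_of_nonneg_left ?_ (hc k i)
  refine (log_principalMinor_le (posDef_frame_gram hJ (hF k).1 he) _).trans_eq ?_
  rw [← (hF k).1, ← Matrix.mul_assoc (eᴴ * e - 1), Matrix.trace_mul_comm _ (F k)ᴴ]
  congr 2
  simp only [Matrix.mul_sub, Matrix.sub_mul, Matrix.mul_assoc, Matrix.one_mul]

theorem frameMoment_isHermitian (c : K → β → ℝ) (F : K → Matrix n β ℂ) :
    (frameMoment c F)ᴴ = frameMoment c F := by
  simp only [frameMoment, Matrix.conjTranspose_sum, Matrix.conjTranspose_smul,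
    Matrix.conjTranspose_mul, conjTranspose_coordProj, Matrix.conjTranspose_conjTranspose,
    Matrix.mul_assoc]
  simp

open scoped Matrix.Norms.L2Operator in
theorem frameMoment_eq_conj_of_nonneg {J : Matrix n n ℂ} (hJ : J * J = 1) (hJH : Jᴴ = J)
    {c : K → β → ℝ} (hc : ∀ k i, 0 ≤ c k i) {F : K → Matrix n β ℂ}
    (hF : ∀ k, F k ∈ isotropicFrames J β)
    (h : ∀ e : Matrix n n ℂ, eᴴ * J * e = J → 0 ≤ frameFunctional c F (eᴴ * e)) :
    frameMoment c F = J * frameMoment c F * J := by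
  set M := frameMoment c F with hM
  have hMH : Mᴴ = M := frameMoment_isHermitian c F
  set Y := M - J * M * J with hY
  have hYH : Yᴴ = Y := by
    simp only [hY, Matrix.conjTranspose_sub, Matrix.conjTranspose_mul, hJH, hMH, Matrix.mul_assoc]
  have hJY : J * Y * J = -Y := by
    have : J * (J * M * J) * J = M := by
      calc _ = (J * J) * M * (J * J) := by simp only [Matrix.mul_assoc]
        _ = M := by rw [hJ, Matrix.one_mul, Matrix.mul_one]
    rw [hY, Matrix.mul_sub, Matrix.sub_mul, this, neg_sub]
  have hJinv : J⁻¹ = J := Matrix.inv_eq_right_inv hJ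
  have hJu : IsUnit J := ⟨⟨J, J, hJ, hJ⟩, rfl⟩
  have hexp : ∀ t : ℝ, ∃ e : Matrix n n ℂ, eᴴ * J * e = J ∧
      eᴴ * e = NormedSpace.exp (t • Y) := by
    intro t
    let Z : Matrix n n ℂ := (t / 2) • Y
    have hZ : Zᴴ = Z := by simp [Z, Matrix.conjTranspose_smul, hYH]
    have h1 : (NormedSpace.exp Z)ᴴ = NormedSpace.exp Z := by
      rw [← Matrix.exp_conjTranspose, hZ]
    have h2 : J * NormedSpace.exp Z * J = NormedSpace.exp (-Z) := by
      have := Matrix.exp_conj J Z hJu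
      rw [hJinv] at this
      rw [← this]
      congr 1
      simp only [Z, Matrix.mul_smul, Matrix.smul_mul, hJY, smul_neg]
    refine ⟨NormedSpace.exp Z, ?_, ?_⟩
    · rw [h1]
      have h3 : J * NormedSpace.exp Z = NormedSpace.exp (-Z) * J := by
        rw [← h2, Matrix.mul_assoc _ J J, hJ, Matrix.mul_one]
      rw [Matrix.mul_assoc, h3, ← Matrix.mul_assoc,
        ← Matrix.exp_add_of_commute _ _ (Commute.neg_right (Commute.refl Z)), add_neg_cancel,
        NormedSpace.exp_zero, Matrix.one_mul]
    · rw [h1, ← Matrix.exp_add_of_commute _ _ (Commute.refl Z), ← add_smul, add_halves]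
  let f : ℝ → ℝ := fun t => ((NormedSpace.exp (t • Y) - 1) * M).trace.re
  have hf0 : f 0 = 0 := by simp [f]
  have hf : ∀ t, 0 ≤ f t := fun t => by
    obtain ⟨e, he, he2⟩ := hexp t
    have := (h e he).trans (frameFunctional_le hJ hc hF he)
    rwa [he2] at this
  let Λ : Matrix n n ℂ →ₗ[ℝ] ℝ := Complex.reLm ∘ₗ
    ((Matrix.traceLinearMap n ℝ ℂ) ∘ₗ (LinearMap.mulRight ℝ M))
  have hderiv : HasDerivAt f ((Y * M).trace.re) 0 := by
    have h1 := (hasDerivAt_exp_smul_const (𝕂 := ℝ) Y 0).sub_const 1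
    have h2 := (LinearMap.toContinuousLinearMap Λ).hasFDerivAt.comp_hasDerivAt (0 : ℝ) h1
    rw [zero_smul, NormedSpace.exp_zero, one_mul] at h2
    exact h2
  have hmin : IsLocalMin f 0 := Filter.Eventually.of_forall fun t => by rw [hf0]; exact hf t
  have h0 := hmin.hasDerivAt_eq_zero hderiv
  have h1 : (Y * (J * M * J)).trace = -(Y * M).trace := by
    rw [← Matrix.mul_assoc, Matrix.trace_mul_comm, ← Matrix.mul_assoc, ← Matrix.mul_assoc,
      hJY, Matrix.neg_mul, Matrix.trace_neg]
  have h2 : (Y * Yᴴ).trace = 2 * (Y * M).trace := by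
    rw [hYH]
    nth_rw 2 [hY]
    rw [Matrix.mul_sub, Matrix.trace_sub, h1]
    ring
  have h3 : (Y * Yᴴ).trace = 0 := by
    have h4 := (Matrix.posSemidef_self_mul_conjTranspose Y).trace_nonneg
    refine Complex.ext ?_ (Complex.nonneg_iff.1 h4).2.symm
    rw [h2, Complex.mul_re, h0]
    have := (Complex.nonneg_iff.1 h4).2
    rw [h2] at this
    simp
  have h5 := Matrix.trace_mul_conjTranspose_self_eq_zero_iff.1 h3
  exact sub_eq_zero.1 h5

theorem exists_balanced_frames {J : Matrix n n ℂ} (hJ : J * J = 1) (hJH : Jᴴ = J)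
    {c : K → β → ℝ} (hc : ∀ k i, 0 ≤ c k i) {F : K → Matrix n β ℂ}
    (hF : ∀ k, F k ∈ isotropicFrames J β) {C : ℝ}
    (hC : ∀ h : Matrix n n ℂ, hᴴ * J * h = J → C ≤ frameFunctional c F (hᴴ * h)) :
    ∃ F' : K → Matrix n β ℂ, (∀ k, F' k ∈ isotropicFrames J β) ∧
      frameMoment c F' = J * frameMoment c F' * J := by
  by_contra! hcon
  have hneg : ∀ F' : K → Matrix n β ℂ, (∀ k, F' k ∈ isotropicFrames J β) →
      ∃ e : Matrix n n ℂ, eᴴ * J * e = J ∧ frameFunctional c F' (eᴴ * e) < 0 := by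
    intro F' hF'
    by_contra! hpos
    exact hcon F' hF' (frameMoment_eq_conj_of_nonneg hJ hJH hc hF' hpos)
  have hcpt : IsCompact (Set.univ.pi fun _ : K => isotropicFrames J β) :=
    isCompact_univ_pi fun _ => isCompact_isotropicFrames J
  obtain ⟨δ, hδ0, hδ⟩ : ∃ δ : ℝ, 0 < δ ∧ ∀ F' ∈ Set.univ.pi fun _ : K => isotropicFrames J β,
      ∃ e : Matrix n n ℂ, eᴴ * J * e = J ∧ frameFunctional c F' (eᴴ * e) < -δ := by
    refine hcpt.induction_on (p := fun S => ∃ δ : ℝ, 0 < δ ∧ ∀ F' ∈ S,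
      ∃ e : Matrix n n ℂ, eᴴ * J * e = J ∧ frameFunctional c F' (eᴴ * e) < -δ) ?_ ?_ ?_ ?_
    · exact ⟨1, one_pos, by simp⟩
    · rintro S S' hS ⟨δ, h0, h⟩
      exact ⟨δ, h0, fun F' hF' => h F' (hS hF')⟩
    · rintro S S' ⟨δ, h0, h⟩ ⟨δ', h0', h'⟩
      refine ⟨min δ δ', lt_min h0 h0', fun F' hF' => ?_⟩
      rcases hF' with hF' | hF'
      · obtain ⟨e, he, hlt⟩ := h F' hF'
        exact ⟨e, he, hlt.trans_le (neg_le_neg (min_le_left _ _))⟩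
      · obtain ⟨e, he, hlt⟩ := h' F' hF'
        exact ⟨e, he, hlt.trans_le (neg_le_neg (min_le_right _ _))⟩
    · intro F' hF'
      obtain ⟨e, he, hlt⟩ := hneg F' fun k => hF' k trivial
      have hcont : ContinuousAt (fun F' => frameFunctional c F' (eᴴ * e)) F' := by
        unfold frameFunctional
        refine tendsto_finsetSum _ fun k _ => tendsto_finsetSum _ fun i _ => ?_
        refine Filter.Tendsto.const_mul _ ?_
        refine (Real.continuousAt_log ?_).tendsto.comp (f := fun F' : K → Matrix n β ℂ =>
          (principalMinor (Finset.Iic i) ((F' k)ᴴ * (eᴴ * e) * F' k)).re) ?_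
        · exact (Complex.pos_iff.1 (principalMinor_pos
            (posDef_frame_gram hJ (hF' k trivial).1 he) _)).1.ne'
        · refine Continuous.tendsto (Complex.continuous_re.comp (Continuous.matrix_det
            (Continuous.matrix_submatrix ?_ _ _))) F'
          fun_prop
      refine ⟨_, mem_nhdsWithin_of_mem_nhds (hcont.eventually (gt_mem_nhds
        (show _ < frameFunctional c F' (eᴴ * e) / 2 by linarith))),
        -(frameFunctional c F' (eᴴ * e) / 2), by linarith, fun F'' hF'' => ⟨e, he, ?_⟩⟩
      rw [neg_neg]
      exact hF''
  let S : Set ℝ := (fun h => frameFunctional c F (hᴴ * h)) '' {h | hᴴ * J * h = J}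
  have hSb : BddBelow S := ⟨C, by rintro _ ⟨h, hh, rfl⟩; exact hC h hh⟩
  have hSn : S.Nonempty := ⟨_, ⟨1, by simp, rfl⟩⟩
  obtain ⟨_, ⟨h, hh, rfl⟩, hlt⟩ := exists_lt_of_csInf_lt hSn (lt_add_of_pos_right (sInf S) hδ0)
  have htr := fun k => exists_isotropicFrame_transform hJ (hF k) hh
  choose F' hF' hF'm using htr
  obtain ⟨e, he, hlt'⟩ := hδ F' fun k _ => hF' k
  have heh : (e * h)ᴴ * J * (e * h) = J := by
    calc _ = hᴴ * (eᴴ * J * e) * h := by simp only [Matrix.conjTranspose_mul, Matrix.mul_assoc]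
      _ = J := by rw [he, hh]
  have hadd : frameFunctional c F ((e * h)ᴴ * (e * h)) =
      frameFunctional c F' (eᴴ * e) + frameFunctional c F (hᴴ * h) := by
    simp only [frameFunctional, ← Finset.sum_add_distrib, ← mul_add]
    refine Finset.sum_congr rfl fun k _ => Finset.sum_congr rfl fun i _ => ?_
    obtain ⟨h1, h1'⟩ := Complex.pos_iff.1 (principalMinor_pos
      (posDef_frame_gram hJ (hF' k).1 he) (Finset.Iic i))
    obtain ⟨h2, h2'⟩ := Complex.pos_iff.1 (principalMinor_pos
      (posDef_frame_gram hJ (hF k).1 hh) (Finset.Iic i))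
    rw [← hF'm k e i, Complex.mul_re, ← h1', ← h2', mul_zero, sub_zero,
      Real.log_mul h1.ne' h2.ne']
  have hle := csInf_le hSb ⟨e * h, heh, rfl⟩
  simp only at hle hlt
  linarith

end Frames

section FlagConfiguration

open scoped ComplexOrder

variable {n β K : Type*} [Fintype n] [DecidableEq n] [Fintype β] [LinearOrder β]
  [LocallyFiniteOrderBot β] [Fintype K]

/-- The coordinate sets of the flags `V` and of their orthogonal complements under the form
which pairs each coordinate `x` with `θ x`. -/
def flagSet (φ : β ↪ n) (θ : Equiv.Perm n) (j : K × β × Bool) : Finset n :=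
  if j.2.2 then (Finset.Iic j.2.1).map φ else ((Finset.Iic j.2.1).map (φ.trans θ.toEmbedding))ᶜ

def flagWeight (c : K → β → ℝ) (j : K × β × Bool) : ℝ := c j.1 j.2.1

theorem sum_flag {M : Type*} [AddCommMonoid M] (f : K × β × Bool → M) :
    ∑ j, f j = ∑ k, ∑ i, (f (k, i, true) + f (k, i, false)) := by
  simp only [Fintype.sum_prod_type, Fintype.sum_bool]

theorem submatrix_one_mul_mul (θ : Equiv.Perm n) (hθ : ∀ x, θ (θ x) = x) (X : Matrix n n ℂ) :
    (1 : Matrix n n ℂ).submatrix θ id * X * (1 : Matrix n n ℂ).submatrix θ id =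
      X.submatrix θ θ := by
  ext i j
  have : ∀ k, θ k = j ↔ k = θ j := fun k =>
    ⟨fun h => by rw [← h, hθ], fun h => by rw [h, hθ]⟩
  simp [Matrix.mul_apply, Matrix.one_apply, this]

theorem mul_coordProj_map_mul (g : Matrix n n ℂ) (φ : β ↪ n) (s : Finset β) :
    g * coordProj ℂ (s.map φ) * gᴴ =
      g.submatrix id φ * coordProj ℂ s * (g.submatrix id φ)ᴴ := by
  ext i j
  rw [Matrix.mul_apply, Matrix.mul_apply]
  simp only [coordProj, Matrix.mul_diagonal, mul_ite, mul_one, mul_zero, ite_mul, zero_mul,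
    ← Finset.sum_filter, Finset.filter_mem_eq_inter, Finset.univ_inter, Finset.sum_map]
  rfl

theorem sum_flag_projections {J : Matrix n n ℂ} (φ : β ↪ n) (θ : Equiv.Perm n)
    (hθ : ∀ x, θ (θ x) = x) {g : K → Matrix n n ℂ}
    (hg : ∀ k, (g k)ᴴ * g k = 1)
    (hgJ : ∀ k, J * g k = g k * (1 : Matrix n n ℂ).submatrix θ id) (hJH : Jᴴ = J)
    (c : K → β → ℝ) :
    ∑ j, (flagWeight c j : ℂ) • (g j.1 * coordProj ℂ (flagSet φ θ j) * (g j.1)ᴴ) =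
      ((∑ k, ∑ i, c k i : ℝ) : ℂ) • (1 : Matrix n n ℂ) +
        (frameMoment c (fun k => (g k).submatrix id φ) -
          J * frameMoment c (fun k => (g k).submatrix id φ) * J) := by
  rw [sum_flag, frameMoment, Matrix.mul_sum, Matrix.sum_mul, Complex.ofReal_sum, Finset.sum_smul,
    ← Finset.sum_sub_distrib, ← Finset.sum_add_distrib]
  refine Finset.sum_congr rfl fun k _ => ?_
  rw [Matrix.mul_sum, Matrix.sum_mul, Complex.ofReal_sum, Finset.sum_smul,
    ← Finset.sum_sub_distrib, ← Finset.sum_add_distrib]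
  refine Finset.sum_congr rfl fun i _ => ?_
  have hgg : g k * (g k)ᴴ = 1 := mul_eq_one_comm.1 (hg k)
  have h1 : ∀ s : Finset n, g k * coordProj ℂ sᶜ * (g k)ᴴ =
      1 - g k * coordProj ℂ s * (g k)ᴴ := by
    intro s
    rw [eq_sub_iff_add_eq, ← Matrix.add_mul, ← Matrix.mul_add, add_comm, coordProj_add_compl,
      Matrix.mul_one, hgg]
  have h2 : J * (g k).submatrix id φ = (g k).submatrix id (φ.trans θ.toEmbedding) := by
    have : J * (g k).submatrix id φ = (J * g k).submatrix id φ := rfl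
    rw [this, hgJ]
    ext x y
    have : ∀ z, θ z = φ y ↔ z = θ (φ y) := fun k =>
      ⟨fun h => by rw [← h, hθ], fun h => by rw [h, hθ]⟩
    simp [Matrix.mul_apply, Matrix.one_apply, this]
  have h3 : J * ((g k).submatrix id φ * coordProj ℂ (Finset.Iic i) *
      ((g k).submatrix id φ)ᴴ) * J =
      (g k).submatrix id (φ.trans θ.toEmbedding) * coordProj ℂ (Finset.Iic i) *
        ((g k).submatrix id (φ.trans θ.toEmbedding))ᴴ := by
    rw [← h2, Matrix.conjTranspose_mul, hJH]
    simp only [Matrix.mul_assoc]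
  simp only [flagSet, flagWeight, if_true, Bool.false_eq_true, if_false]
  rw [h1, mul_coordProj_map_mul, mul_coordProj_map_mul, Matrix.mul_smul, Matrix.smul_mul, h3,
    smul_sub]
  abel

theorem rankBound_of_balanced_flags {J : Matrix n n ℂ} (φ : β ↪ n) (θ : Equiv.Perm n)
    (hθ : ∀ x, θ (θ x) = x) (hJH : Jᴴ = J) {g : K → Matrix n n ℂ}
    (hg : ∀ k, (g k)ᴴ * g k = 1)
    (hgJ : ∀ k, J * g k = g k * (1 : Matrix n n ℂ).submatrix θ id)
    {c : K → β → ℝ} (hc : ∀ k i, 0 ≤ c k i)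
    (h : frameMoment c (fun k => (g k).submatrix id φ) =
      J * frameMoment c (fun k => (g k).submatrix id φ) * J) :
    RankBound (flagSet φ θ) (flagWeight c) (∑ k, ∑ i, c k i) fun j : K × β × Bool => g j.1 := by
  refine RankBound.of_balanced (fun j => hc _ _) (fun j => mul_eq_one_comm.1 (hg j.1)) ?_
  rw [sum_flag_projections φ θ hθ hg hgJ hJH c, ← h, sub_self, add_zero]

theorem logDetFunctional_flag {J : Matrix n n ℂ} (φ : β ↪ n) (θ : Equiv.Perm n)
    (hθ : ∀ x, θ (θ x) = x) (hJ : J * J = 1) {g : K → Matrix n n ℂ}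
    (hg : ∀ k, (g k)ᴴ * g k = 1)
    (hgJ : ∀ k, J * g k = g k * (1 : Matrix n n ℂ).submatrix θ id)
    (c : K → β → ℝ) (b : ℝ) {h : Matrix n n ℂ} (hh : hᴴ * J * h = J) :
    logDetFunctional (flagSet φ θ) (flagWeight c) b (fun j : K × β × Bool => g j.1) (hᴴ * h) =
      2 * frameFunctional c (fun k => (g k).submatrix id φ) (hᴴ * h) := by
  have hh' : h * J * hᴴ = J := by
    have h1 : (hᴴ * J) * (h * J) = 1 := by rw [← Matrix.mul_assoc, hh, hJ]
    have h2 := mul_eq_one_comm.1 h1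
    calc h * J * hᴴ = h * J * (hᴴ * J) * J := by
          rw [Matrix.mul_assoc, Matrix.mul_assoc, Matrix.mul_assoc, Matrix.mul_assoc, hJ,
            Matrix.mul_one]
      _ = J := by rw [h2, Matrix.one_mul]
  have hHJ : hᴴ * h * J * (hᴴ * h) = J := by
    calc _ = hᴴ * (h * J * hᴴ) * h := by simp only [Matrix.mul_assoc]
      _ = J := by rw [hh', hh]
  have hu : IsUnit h := by
    have h1 : (J * hᴴ * J) * h = 1 := by
      rw [Matrix.mul_assoc, Matrix.mul_assoc, ← Matrix.mul_assoc hᴴ, hh, hJ]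
    exact ⟨⟨h, _, mul_eq_one_comm.1 h1, h1⟩, rfl⟩
  have hpd : (hᴴ * h).PosDef :=
    Matrix.PosDef.conjTranspose_mul_self _ (Matrix.mulVec_injective_of_isUnit hu)
  have hdet : (hᴴ * h).det = 1 := by
    have h1 : (hᴴ * h).det * (hᴴ * h).det = 1 := by
      have h2 := congr_arg Matrix.det (congr_arg (· * J) hHJ)
      have h3 := congr_arg Matrix.det hJ
      simp only [Matrix.det_mul, Matrix.det_one] at h2 h3 ⊢
      linear_combination h2 + (1 - (hᴴ.det * h.det) * (hᴴ.det * h.det)) * h3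
    rcases mul_self_eq_one_iff.1 h1 with h2 | h2
    · exact h2
    · have := hpd.det_pos
      rw [h2] at this
      exact absurd (Complex.pos_iff.1 this).1 (by norm_num)
  rw [logDetFunctional, sum_flag, hdet, Complex.one_re, Real.log_one, mul_zero, sub_zero,
    frameFunctional, Finset.mul_sum]
  refine Finset.sum_congr rfl fun k _ => ?_
  rw [Finset.mul_sum]
  refine Finset.sum_congr rfl fun i _ => ?_
  simp only [flagSet, flagWeight, if_true, Bool.false_eq_true, if_false]
  set X := (g k)ᴴ * (hᴴ * h) * g k with hX
  have hXJ : X * X.submatrix θ θ = 1 := by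
    have hgg : g k * (g k)ᴴ = 1 := mul_eq_one_comm.1 (hg k)
    rw [← submatrix_one_mul_mul θ hθ]
    calc _ = (g k)ᴴ * (hᴴ * h) * (g k * (1 : Matrix n n ℂ).submatrix θ id) * (g k)ᴴ *
          (hᴴ * h) * (g k * (1 : Matrix n n ℂ).submatrix θ id) := by
          simp only [hX, Matrix.mul_assoc]
      _ = (g k)ᴴ * ((hᴴ * h) * J * (g k * (g k)ᴴ) * (hᴴ * h)) * J * g k := by
          rw [← hgJ]
          simp only [Matrix.mul_assoc]
      _ = 1 := by
          rw [hgg, Matrix.mul_one, hHJ, Matrix.mul_assoc _ J J, hJ, Matrix.mul_one, hg]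
  have hXdet : X.det = 1 := by
    have := congr_arg Matrix.det (hg k)
    rw [Matrix.det_mul, Matrix.det_one] at this
    rw [hX, Matrix.det_mul, Matrix.det_mul, hdet, mul_one, this]
  have h1 : principalMinor ((Finset.Iic i).map (φ.trans θ.toEmbedding))ᶜ X =
      principalMinor ((Finset.Iic i).map φ) X := by
    rw [principalMinor_eq_det_mul_compl _ hXJ, hXdet, one_mul, compl_compl, principalMinor_map,
      principalMinor_map]
    congr 1
    ext x y
    simp [hθ]
  have h2 : X.submatrix φ φ =
      ((g k).submatrix id φ)ᴴ * (hᴴ * h) * (g k).submatrix id φ := rfl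
  rw [h1, principalMinor_map, h2]
  ring

theorem exists_balanced_of_rankBound {J : Matrix n n ℂ} (φ : β ↪ n) (θ : Equiv.Perm n)
    (hθ : ∀ x, θ (θ x) = x) (hφ : ∀ i j, θ (φ i) ≠ φ j) (hJ : J * J = 1) (hJH : Jᴴ = J)
    {g : K → Matrix n n ℂ} (hg : ∀ k, (g k)ᴴ * g k = 1)
    (hgJ : ∀ k, J * g k = g k * (1 : Matrix n n ℂ).submatrix θ id)
    {c : K → β → ℝ} (hc : ∀ k i, 0 ≤ c k i)
    (h : RankBound (flagSet φ θ) (flagWeight c) (∑ k, ∑ i, c k i)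
      fun j : K × β × Bool => g j.1) :
    ∃ F : K → Matrix n β ℂ, (∀ k, F k ∈ isotropicFrames J β) ∧
      frameMoment c F = J * frameMoment c F * J := by
  have hdet : ∀ j : K × β × Bool, IsUnit (g j.1).det := fun j => by
    have := congr_arg Matrix.det (hg j.1)
    rw [Matrix.det_mul, Matrix.det_one, mul_comm] at this
    exact IsUnit.of_mul_eq_one _ this
  have hdim : (∑ k, ∑ i, c k i) * Fintype.card n =
      ∑ j : K × β × Bool, flagWeight c j * (flagSet φ θ j).card := by
    rw [sum_flag, Finset.sum_mul]
    refine Finset.sum_congr rfl fun k _ => ?_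
    rw [Finset.sum_mul]
    refine Finset.sum_congr rfl fun i _ => ?_
    have h1 := Finset.card_add_card_compl ((Finset.Iic i).map (φ.trans θ.toEmbedding))
    simp only [flagSet, flagWeight, if_true, Bool.false_eq_true, if_false, ← h1]
    simp only [Finset.card_map]
    push_cast
    ring
  obtain ⟨C, hC⟩ := RankBound.exists_logDet_lower_bound (a := flagWeight c)
    (fun j => hc _ _) hdet hdim h
  refine exists_balanced_frames hJ hJH hc (F := fun k => (g k).submatrix id φ) (C := C / 2)
    (fun k => ⟨?_, ?_⟩) fun e he => ?_
  · have : ((g k).submatrix id φ)ᴴ * (g k).submatrix id φ =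
      ((g k)ᴴ * g k).submatrix φ φ := rfl
    rw [this, hg, Matrix.submatrix_one _ φ.injective]
  · have : ((g k).submatrix id φ)ᴴ * J * (g k).submatrix id φ =
      ((g k)ᴴ * J * g k).submatrix φ φ := rfl
    rw [this, Matrix.mul_assoc, hgJ, ← Matrix.mul_assoc, hg, Matrix.one_mul]
    ext i j
    simp [hφ]
  · have hu : IsUnit e := by
      have h1 : (J * eᴴ * J) * e = 1 := by
        rw [Matrix.mul_assoc, Matrix.mul_assoc, ← Matrix.mul_assoc eᴴ, he, hJ]
      exact ⟨⟨e, _, mul_eq_one_comm.1 h1, h1⟩, rfl⟩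
    have := hC (eᴴ * e)
      (Matrix.PosDef.conjTranspose_mul_self _ (Matrix.mulVec_injective_of_isUnit hu))
    rw [logDetFunctional_flag φ θ hθ hJ hg hgJ c _ he] at this
    linarith

end FlagConfiguration

section UnitaryPath

open scoped Matrix.Norms.L2Operator

variable {n : Type*} [Fintype n] [DecidableEq n]

theorem exists_isHermitian_exp_eq {U : Matrix n n ℂ} (hU : Uᴴ * U = 1) :
    ∃ X : Matrix n n ℂ, Xᴴ = X ∧ NormedSpace.exp (Complex.I • X) = U := by
  let _ : CStarAlgebra (Matrix n n ℂ) := {}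
  have hu : U ∈ unitary (Matrix n n ℂ) := ⟨hU, mul_eq_one_comm.1 hU⟩
  have hn : IsStarNormal U := ⟨by
    rw [Commute, SemiconjBy]; exact hu.1.trans hu.2.symm⟩
  refine ⟨cfc (fun z => (Complex.arg z : ℂ)) U, IsSelfAdjoint.cfc_arg U, ?_⟩
  have hfin := Matrix.finite_spectrum U
  have hc : ContinuousOn (fun z => (Complex.arg z : ℂ)) (spectrum ℂ U) := hfin.continuousOn _
  rw [← CFC.exp_eq_normedSpace_exp (𝕜 := ℂ) (ha := ?_), ← cfc_smul .., ← cfc_comp' ..]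
  · conv_rhs => rw [← cfc_id' ℂ U]
    refine cfc_congr fun y hy => ?_
    have h1 : ‖y‖ = 1 := spectrum.norm_eq_one_of_unitary hu hy
    have h2 : Complex.I * y.arg = Complex.log y :=
      Complex.ext (by simp [Complex.log_re, h1]) (by simp [Complex.log_im])
    have h3 : y ≠ 0 := by
      rintro rfl
      simp at h1
    simpa [← Complex.exp_eq_exp_ℂ, h2] using Complex.exp_log h3
  · rw [← cfc_smul ..]
    exact cfc_predicate _ _

theorem exists_analytic_unitary_path {U₀ U₁ : Matrix n n ℂ} (h₀ : U₀ᴴ * U₀ = 1)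
    (h₁ : U₁ᴴ * U₁ = 1) :
    ∃ u : ℝ → Matrix n n ℂ, (∀ i j, AnalyticOnNhd ℝ (fun t => u t i j) Set.univ) ∧
      (∀ t, (u t)ᴴ * u t = 1) ∧ u 0 = U₀ ∧ u 1 = U₁ := by
  have h₀' : U₀ * U₀ᴴ = 1 := mul_eq_one_comm.1 h₀
  obtain ⟨X, hX, hexp⟩ := exists_isHermitian_exp_eq (U := U₀ᴴ * U₁) (by
    rw [Matrix.conjTranspose_mul, Matrix.conjTranspose_conjTranspose, Matrix.mul_assoc,
      ← Matrix.mul_assoc U₀, h₀', Matrix.one_mul, h₁])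
  refine ⟨fun t => U₀ * NormedSpace.exp (t • (Complex.I • X)), fun i j t _ => ?_, fun t => ?_,
    by simp, ?_⟩
  · have h1 : AnalyticAt ℝ (fun t : ℝ => NormedSpace.exp (t • (Complex.I • X))) t :=
      (NormedSpace.exp_analytic (𝕂 := ℝ) _).comp (analyticAt_id.smul analyticAt_const)
    let Λ : Matrix n n ℂ →ₗ[ℝ] ℂ :=
      { toFun := fun Y => (U₀ * Y) i j
        map_add' := fun Y Z => by rw [Matrix.mul_add, Matrix.add_apply]
        map_smul' := fun r Y => by rw [Matrix.mul_smul, Matrix.smul_apply, RingHom.id_apply] }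
    exact ((LinearMap.toContinuousLinearMap Λ).analyticAt _).comp h1
  · have h1 : (NormedSpace.exp (t • (Complex.I • X)))ᴴ =
        NormedSpace.exp (-(t • (Complex.I • X))) := by
      rw [← Matrix.exp_conjTranspose]
      simp [Matrix.conjTranspose_smul, hX]
    rw [Matrix.conjTranspose_mul, Matrix.mul_assoc, ← Matrix.mul_assoc _ U₀, h₀, Matrix.one_mul,
      h1, ← Matrix.exp_add_of_commute _ _ 
        (Commute.neg_left (Commute.refl (t • (Complex.I • X)))), neg_add_cancel,
      NormedSpace.exp_zero]
  · beta_reduce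
    rw [one_smul, hexp, ← Matrix.mul_assoc, h₀', Matrix.one_mul]

end UnitaryPath

section AnalyticRing

/-- The algebra of complex valued real analytic functions on the real line. -/
def analyticFunctions : Subalgebra ℂ (ℝ → ℂ) where
  carrier := {f | AnalyticOnNhd ℝ f Set.univ}
  mul_mem' hf hg := hf.mul hg
  add_mem' hf hg := hf.add hg
  algebraMap_mem' _ := analyticOnNhd_const

def analyticFunctions.eval (t : ℝ) : analyticFunctions →ₐ[ℂ] ℂ :=
  (Pi.evalAlgHom ℂ (fun _ : ℝ => ℂ) t).comp analyticFunctions.val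

theorem analyticFunctions.exists_eval_ne_zero {D D' : analyticFunctions} {t t' : ℝ}
    (h : eval t D ≠ 0) (h' : eval t' D' ≠ 0) : ∃ x, eval x D ≠ 0 ∧ eval x D' ≠ 0 := by
  have hne : ∀ (E : analyticFunctions) (r : ℝ), eval r E ≠ 0 →
      ∀ᶠ x in nhdsWithin (0 : ℝ) {0}ᶜ, eval x E ≠ 0 := by
    intro E r hr
    by_contra hcon
    have hfr : ∃ᶠ x in nhdsWithin (0 : ℝ) {0}ᶜ, (E : ℝ → ℂ) x = 0 := hcon
    have hz := AnalyticOnNhd.eqOn_zero_of_preconnected_of_frequently_eq_zero E.2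
      isPreconnected_univ (Set.mem_univ 0) hfr
    exact hr (hz (Set.mem_univ r))
  exact ((hne D t h).and (hne D' t' h')).exists

variable {ι Λ : Type*} [Fintype ι] [DecidableEq ι] [Fintype Λ]

/-- The rank bounds at two points of an analytic family add up at some point of the family. -/
theorem RankBound.exists_add {s : Λ → Finset ι} {a a' : Λ → ℝ} {b b' : ℝ} (ha : ∀ j, 0 ≤ a j)
    (ha' : ∀ j, 0 ≤ a' j) (hb : 0 ≤ b) (hb' : 0 ≤ b') {g : ℝ → Λ → Matrix ι ι ℂ}
    (hg : ∀ j x y, AnalyticOnNhd ℝ (fun t => g t j x y) Set.univ) {t t' : ℝ}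
    (h : RankBound s a b (g t)) (h' : RankBound s a' b' (g t')) :
    ∃ x, RankBound s (a + a') (b + b') (g x) := by
  let G : Λ → Matrix ι ι analyticFunctions := fun j =>
    Matrix.of fun x y => ⟨fun t => g t j x y, hg j x y⟩
  have hG : ∀ t, (fun j => (G j).map (analyticFunctions.eval t)) = g t := fun t => rfl
  obtain ⟨D, hD, hD'⟩ := RankBound.exists_generic ha G (analyticFunctions.eval t) hb
    (by rw [hG]; exact h)
  obtain ⟨E, hE, hE'⟩ := RankBound.exists_generic ha' G (analyticFunctions.eval t') hb'
    (by rw [hG]; exact h')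
  obtain ⟨x, hx, hx'⟩ := analyticFunctions.exists_eval_ne_zero hD hE
  have h1 := hD' _ hx
  have h2 := hE' _ hx'
  rw [hG] at h1 h2
  exact ⟨x, h1.add h2⟩

end AnalyticRing

section IsometryExtension

variable {ι : Type*} [Fintype ι] [DecidableEq ι]

theorem exists_unitary_extension (W : Matrix ι ι ℂ) (s : Set ι)
    (h : ∀ i ∈ s, ∀ j ∈ s, (Wᴴ * W) i j = if i = j then 1 else 0) :
    ∃ U : Matrix ι ι ℂ, Uᴴ * U = 1 ∧ ∀ j ∈ s, ∀ x, U x j = W x j := by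
  let v : ι → EuclideanSpace ℂ ι := fun j => WithLp.toLp 2 fun x => W x j
  have hinner : ∀ i j, inner ℂ (v i) (v j) = (Wᴴ * W) i j := by
    intro i j
    simp [v, PiLp.inner_apply, Matrix.mul_apply, mul_comm]
  have hv : Orthonormal ℂ (s.domRestrict v) := by
    classical
    rw [orthonormal_iff_ite]
    rintro ⟨i, hi⟩ ⟨j, hj⟩
    change inner ℂ (v i) (v j) = _
    rw [hinner, h i hi j hj]
    simp only [Subtype.mk.injEq]
  obtain ⟨b, hb⟩ := hv.exists_orthonormalBasis_extension_of_card_eq (ι := ι) (by simp)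
  refine ⟨Matrix.of fun x j => b j x, ?_, fun j hj x => ?_⟩
  · ext i j
    have := orthonormal_iff_ite.1 b.orthonormal i j
    rw [Matrix.one_apply, ← this]
    simp [PiLp.inner_apply, Matrix.mul_apply, mul_comm]
  · rw [Matrix.of_apply, hb j hj]

end IsometryExtension

section Blocks

open scoped ComplexOrder

variable {β γ K : Type*} [Fintype β] [LinearOrder β] [LocallyFiniteOrderBot β]
  [Fintype γ] [DecidableEq γ] [Fintype K]

/-- The diagonal matrix with entries `1` and `-1` on the two summands. -/
def signMatrix (α β : Type*) [DecidableEq α] [DecidableEq β] : Matrix (α ⊕ β) (α ⊕ β) ℂ :=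
  Matrix.fromBlocks 1 0 0 (-1)

theorem signMatrix_mul_self (α β : Type*) [Fintype α] [Fintype β] [DecidableEq α]
    [DecidableEq β] : signMatrix α β * signMatrix α β = 1 := by
  simp [signMatrix, Matrix.fromBlocks_multiply]

theorem conjTranspose_signMatrix (α β : Type*) [DecidableEq α] [DecidableEq β] :
    (signMatrix α β)ᴴ = signMatrix α β := by
  simp [signMatrix, Matrix.fromBlocks_conjTranspose]

theorem eq_signMatrix_conj_iff {α : Type*} [Fintype α] [DecidableEq α]
    {M : Matrix (α ⊕ β) (α ⊕ β) ℂ} (hM : Mᴴ = M) :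
    M = signMatrix α β * M * signMatrix α β ↔ M.toBlocks₁₂ = 0 := by
  have h21 : M.toBlocks₂₁ = (M.toBlocks₁₂)ᴴ := by
    ext i j
    exact (congr_fun (congr_fun hM (Sum.inr i)) (Sum.inl j)).symm
  have hconj : signMatrix α β * M * signMatrix α β =
      Matrix.fromBlocks M.toBlocks₁₁ (-M.toBlocks₁₂) (-M.toBlocks₂₁) M.toBlocks₂₂ := by
    conv_lhs => rw [← Matrix.fromBlocks_toBlocks M]
    simp [signMatrix, Matrix.fromBlocks_multiply]
  rw [hconj]
  constructor
  · intro h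
    have := congr_arg Matrix.toBlocks₁₂ h
    rw [Matrix.toBlocks_fromBlocks₁₂] at this
    ext i j
    exact self_eq_neg.1 (congr_fun (congr_fun this i) j)
  · intro h
    conv_lhs => rw [← Matrix.fromBlocks_toBlocks M]
    rw [h21, h]
    simp

theorem toBlocks₁₂_frameMoment {α : Type*} (c : K → β → ℝ) (F : K → Matrix (α ⊕ β) β ℂ) :
    (frameMoment c F).toBlocks₁₂ = ∑ k, (F k).toRows₁ *
      Matrix.diagonal (fun j => ((∑ i, if j ≤ i then c k i else 0 : ℝ) : ℂ)) *
        ((F k).toRows₂)ᴴ := by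
  have hentry : ∀ k i x y, (F k * coordProj ℂ (Finset.Iic i) * (F k)ᴴ) (Sum.inl x) (Sum.inr y) =
      ∑ j, F k (Sum.inl x) j * (if j ≤ i then 1 else 0) * star (F k (Sum.inr y) j) := by
    intro k i x y
    rw [Matrix.mul_apply]
    refine Finset.sum_congr rfl fun j _ => ?_
    rw [coordProj, Matrix.mul_diagonal, Matrix.conjTranspose_apply]
    simp only [Finset.mem_Iic]
  ext x y
  simp only [frameMoment, Matrix.toBlocks₁₂, Matrix.of_apply, Matrix.sum_apply,
    Matrix.smul_apply, hentry, Finset.smul_sum]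
  refine Finset.sum_congr rfl fun k _ => ?_
  rw [Matrix.mul_apply, Finset.sum_comm]
  refine Finset.sum_congr rfl fun j _ => ?_
  rw [Matrix.mul_diagonal, Matrix.toRows₁_apply, Matrix.conjTranspose_apply,
    Matrix.toRows₂_apply]
  push_cast
  rw [Finset.mul_sum, Finset.sum_mul]
  refine Finset.sum_congr rfl fun i _ => ?_
  split_ifs
  · simp only [smul_eq_mul]; ring
  · simp

/-- The involution exchanging the two copies of `β`. -/
def swapCopies (β γ : Type*) : Equiv.Perm ((β ⊕ γ) ⊕ β) where
  toFun := Sum.elim (Sum.elim Sum.inr fun c => Sum.inl (Sum.inr c)) fun j => Sum.inl (Sum.inl j)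
  invFun := Sum.elim (Sum.elim Sum.inr fun c => Sum.inl (Sum.inr c)) fun j => Sum.inl (Sum.inl j)
  left_inv := by rintro ((x | x) | x) <;> rfl
  right_inv := by rintro ((x | x) | x) <;> rfl

theorem swapCopies_swapCopies (x : (β ⊕ γ) ⊕ β) : swapCopies β γ (swapCopies β γ x) = x :=
  (swapCopies β γ).left_inv x

/-- A unitary matrix conjugating `signMatrix` to the permutation matrix of `swapCopies`. -/
noncomputable def cayleyMatrix (β γ : Type*) [DecidableEq β] [DecidableEq γ] :
    Matrix ((β ⊕ γ) ⊕ β) ((β ⊕ γ) ⊕ β) ℂ :=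
  Matrix.fromBlocks (Matrix.fromBlocks ((Real.sqrt 2 : ℂ)⁻¹ • 1) 0 0 1)
    (Matrix.fromRows ((Real.sqrt 2 : ℂ)⁻¹ • 1) 0)
    (Matrix.fromCols ((Real.sqrt 2 : ℂ)⁻¹ • 1) 0) (-((Real.sqrt 2 : ℂ)⁻¹ • 1))

theorem inv_sqrt_two_mul_self : (Real.sqrt 2 : ℂ)⁻¹ * (Real.sqrt 2 : ℂ)⁻¹ = 1 / 2 := by
  rw [← mul_inv, ← Complex.ofReal_mul, Real.mul_self_sqrt (by norm_num)]
  norm_num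

theorem cayleyMatrix_unitary : (cayleyMatrix β γ)ᴴ * cayleyMatrix β γ = 1 := by
  have hmul := inv_sqrt_two_mul_self
  have hstar : star (Real.sqrt 2 : ℂ)⁻¹ = (Real.sqrt 2 : ℂ)⁻¹ := by simp
  rw [cayleyMatrix]
  generalize (Real.sqrt 2 : ℂ)⁻¹ = r at hmul hstar
  have e1 : (Matrix.fromRows (r • (1 : Matrix β β ℂ)) (0 : Matrix γ β ℂ))ᴴ =
      Matrix.fromCols (r • 1) 0 := by
    rw [Matrix.conjTranspose_fromRows_eq_fromCols_conjTranspose]; simp [hstar]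
  have e2 : (Matrix.fromCols (r • (1 : Matrix β β ℂ)) (0 : Matrix β γ ℂ))ᴴ =
      Matrix.fromRows (r • 1) 0 := by
    rw [Matrix.conjTranspose_fromCols_eq_fromRows_conjTranspose]; simp [hstar]
  rw [Matrix.fromBlocks_conjTranspose, e1, e2, Matrix.fromBlocks_conjTranspose,
    Matrix.fromBlocks_multiply]
  ext i j
  rcases i with (i | i) | i <;> rcases j with (j | j) | j <;>
    simp [Matrix.fromBlocks_multiply, hstar, Matrix.mul_apply, Matrix.one_apply, hmul]
  all_goals split_ifs <;> norm_num

theorem signMatrix_mul_cayleyMatrix : signMatrix (β ⊕ γ) β * cayleyMatrix β γ =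
    cayleyMatrix β γ * (1 : Matrix _ _ ℂ).submatrix (swapCopies β γ) id := by
  have h : ∀ X : Matrix ((β ⊕ γ) ⊕ β) ((β ⊕ γ) ⊕ β) ℂ,
      X * (1 : Matrix _ _ ℂ).submatrix (swapCopies β γ) id = X.submatrix id (swapCopies β γ) := by
    intro X
    ext i j
    have : ∀ k, swapCopies β γ k = j ↔ k = swapCopies β γ j := fun k =>
      ⟨fun h => by rw [← h, swapCopies_swapCopies], fun h => by rw [h, swapCopies_swapCopies]⟩
    simp [Matrix.mul_apply, Matrix.one_apply, this]
  rw [h, signMatrix, cayleyMatrix, Matrix.fromBlocks_multiply]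
  ext i j
  rcases i with (i | i) | i <;> rcases j with (j | j) | j <;>
    simp [swapCopies]

end Blocks

section VanishingSum

open scoped ComplexOrder

variable {β γ K : Type*} [Fintype β] [LinearOrder β] [LocallyFiniteOrderBot β]
  [Fintype γ] [DecidableEq γ] [Fintype K]

/-- There are matrices with singular values `τ k` whose sum over `k` vanishes, expressed through
their singular value decompositions. -/
def VanishingSum {β K : Type*} (α : Type*) [Fintype α] [Fintype β] [DecidableEq β] [Fintype K]
    (τ : K → β → ℝ) : Prop :=
  ∃ (u : K → Matrix α β ℂ) (v : K → Matrix β β ℂ), (∀ k, (u k)ᴴ * u k = 1) ∧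
    (∀ k, (v k)ᴴ * v k = 1) ∧
    ∑ k, u k * Matrix.diagonal (fun j => (τ k j : ℂ)) * (v k)ᴴ = 0

/-- The sums of a sequence over the indices at least `j`. -/
def tailSum {β : Type*} [Fintype β] [LinearOrder β] (c : β → ℝ) (j : β) : ℝ :=
  ∑ i, if j ≤ i then c i else 0

theorem tailSum_add (c c' : β → ℝ) : tailSum (c + c') = tailSum c + tailSum c' := by
  ext j
  simp only [tailSum, Pi.add_apply, ← Finset.sum_add_distrib]
  refine Finset.sum_congr rfl fun i _ => ?_
  split_ifs <;> simp

theorem exists_unitary_submatrix_inl (u : Matrix (β ⊕ γ) β ℂ) (hu : uᴴ * u = 1) :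
    ∃ U : Matrix (β ⊕ γ) (β ⊕ γ) ℂ, Uᴴ * U = 1 ∧ U.submatrix id Sum.inl = u := by
  obtain ⟨U, hU, hUu⟩ := exists_unitary_extension (Matrix.fromCols u 0) (Set.range Sum.inl) (by
    rintro _ ⟨i, rfl⟩ _ ⟨j, rfl⟩
    have := congr_fun (congr_fun hu i) j
    rw [Matrix.one_apply, Matrix.mul_apply] at this
    simpa [Matrix.mul_apply] using this)
  refine ⟨U, hU, ?_⟩
  ext x j
  rw [Matrix.submatrix_apply, hUu _ ⟨j, rfl⟩]
  rfl

/-- The unitary matrices adapted to a pair of unitary matrices on the two summands. -/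
noncomputable def pairFrame (U : Matrix (β ⊕ γ) (β ⊕ γ) ℂ) (V : Matrix β β ℂ) :
    Matrix ((β ⊕ γ) ⊕ β) ((β ⊕ γ) ⊕ β) ℂ :=
  Matrix.fromBlocks U 0 0 V * cayleyMatrix β γ

theorem pairFrame_unitary {U : Matrix (β ⊕ γ) (β ⊕ γ) ℂ} {V : Matrix β β ℂ}
    (hU : Uᴴ * U = 1) (hV : Vᴴ * V = 1) : (pairFrame U V)ᴴ * pairFrame U V = 1 := by
  have h : (Matrix.fromBlocks U 0 0 V)ᴴ * Matrix.fromBlocks U 0 0 V = 1 := by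
    rw [Matrix.fromBlocks_conjTranspose, Matrix.fromBlocks_multiply]
    simp [hU, hV]
  rw [pairFrame, Matrix.conjTranspose_mul, Matrix.mul_assoc,
    ← Matrix.mul_assoc (Matrix.fromBlocks U 0 0 V)ᴴ, h, Matrix.one_mul, cayleyMatrix_unitary]

theorem signMatrix_mul_pairFrame (U : Matrix (β ⊕ γ) (β ⊕ γ) ℂ) (V : Matrix β β ℂ) :
    signMatrix (β ⊕ γ) β * pairFrame U V =
      pairFrame U V * (1 : Matrix _ _ ℂ).submatrix (swapCopies β γ) id := by
  have h : signMatrix (β ⊕ γ) β * Matrix.fromBlocks U 0 0 V =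
      Matrix.fromBlocks U 0 0 V * signMatrix (β ⊕ γ) β := by
    simp [signMatrix, Matrix.fromBlocks_multiply]
  rw [pairFrame, ← Matrix.mul_assoc, h, Matrix.mul_assoc, signMatrix_mul_cayleyMatrix,
    Matrix.mul_assoc]

/-- The embedding of `β` as the first summand. -/
def firstCopy (β γ : Type*) : β ↪ (β ⊕ γ) ⊕ β :=
  Function.Embedding.inl.trans Function.Embedding.inl

theorem toRows₁_pairFrame (U : Matrix (β ⊕ γ) (β ⊕ γ) ℂ) (V : Matrix β β ℂ) :
    ((pairFrame U V).submatrix id (firstCopy β γ)).toRows₁ =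
      (Real.sqrt 2 : ℂ)⁻¹ • U.submatrix id Sum.inl := by
  ext x j
  simp [pairFrame, cayleyMatrix, firstCopy, Matrix.toRows₁, Matrix.mul_apply, Matrix.one_apply,
    mul_comm]

theorem toRows₂_pairFrame (U : Matrix (β ⊕ γ) (β ⊕ γ) ℂ) (V : Matrix β β ℂ) :
    ((pairFrame U V).submatrix id (firstCopy β γ)).toRows₂ = (Real.sqrt 2 : ℂ)⁻¹ • V := by
  ext x j
  simp [pairFrame, cayleyMatrix, firstCopy, Matrix.toRows₂, Matrix.mul_apply, Matrix.one_apply,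
    mul_comm]

theorem balanced_iff_sum_eq_zero (c : K → β → ℝ) (F : K → Matrix ((β ⊕ γ) ⊕ β) β ℂ) :
    frameMoment c F = signMatrix (β ⊕ γ) β * frameMoment c F * signMatrix (β ⊕ γ) β ↔
      ∑ k, (F k).toRows₁ * Matrix.diagonal (fun j => (tailSum (c k) j : ℂ)) *
        ((F k).toRows₂)ᴴ = 0 := by
  rw [eq_signMatrix_conj_iff (frameMoment_isHermitian c F), toBlocks₁₂_frameMoment]
  rfl

theorem rankBound_pairFrame {c : K → β → ℝ} (hc : ∀ k i, 0 ≤ c k i)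
    {U : K → Matrix (β ⊕ γ) (β ⊕ γ) ℂ} {V : K → Matrix β β ℂ}
    (hU : ∀ k, (U k)ᴴ * U k = 1) (hV : ∀ k, (V k)ᴴ * V k = 1)
    (h : ∑ k, (U k).submatrix id Sum.inl *
      Matrix.diagonal (fun j => (tailSum (c k) j : ℂ)) * (V k)ᴴ = 0) :
    RankBound (flagSet (firstCopy β γ) (swapCopies β γ)) (flagWeight c) (∑ k, ∑ i, c k i)
      fun j : K × β × Bool => pairFrame (U j.1) (V j.1) := by
  refine rankBound_of_balanced_flags (J := signMatrix (β ⊕ γ) β)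
    (g := fun k => pairFrame (U k) (V k)) _ _ swapCopies_swapCopies
    (conjTranspose_signMatrix _ _) (fun k => pairFrame_unitary (hU k) (hV k))
    (fun k => signMatrix_mul_pairFrame _ _) hc ?_
  rw [balanced_iff_sum_eq_zero]
  simp only [toRows₁_pairFrame, toRows₂_pairFrame, Matrix.conjTranspose_smul, Matrix.smul_mul,
    Matrix.mul_smul, ← Finset.smul_sum, h, smul_zero]

theorem sqrt_two_smul_isometry {δ : Type*} [Fintype δ] {X : Matrix δ β ℂ}
    (hX : Xᴴ * X = (1 / 2 : ℂ) • 1) :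
    ((Real.sqrt 2 : ℂ) • X)ᴴ * ((Real.sqrt 2 : ℂ) • X) = 1 := by
  have hs : (Real.sqrt 2 : ℂ) * (Real.sqrt 2 : ℂ) = 2 := by
    rw [← Complex.ofReal_mul, Real.mul_self_sqrt (by norm_num)]; norm_num
  rw [Matrix.conjTranspose_smul, Matrix.smul_mul, Matrix.mul_smul, hX, smul_smul, smul_smul]
  simp [hs]

theorem vanishingSum_of_isotropicFrames {c : K → β → ℝ} {F : K → Matrix ((β ⊕ γ) ⊕ β) β ℂ}
    (hF : ∀ k, F k ∈ isotropicFrames (signMatrix (β ⊕ γ) β) β)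
    (h : frameMoment c F = signMatrix (β ⊕ γ) β * frameMoment c F * signMatrix (β ⊕ γ) β) :
    VanishingSum (β ⊕ γ) fun k => tailSum (c k) := by
  rw [balanced_iff_sum_eq_zero] at h
  have hrows : ∀ k, ((F k).toRows₁)ᴴ * (F k).toRows₁ = (1 / 2 : ℂ) • 1 ∧
      ((F k).toRows₂)ᴴ * (F k).toRows₂ = (1 / 2 : ℂ) • 1 := by
    intro k
    obtain ⟨h1, h2⟩ := hF k
    have e : F k = Matrix.fromRows (F k).toRows₁ (F k).toRows₂ :=
      (Matrix.fromRows_toRows _).symm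
    rw [e, Matrix.conjTranspose_fromRows_eq_fromCols_conjTranspose,
      Matrix.fromCols_mul_fromRows] at h1
    rw [e, Matrix.conjTranspose_fromRows_eq_fromCols_conjTranspose, signMatrix,
      Matrix.fromCols_mul_fromBlocks, Matrix.fromCols_mul_fromRows] at h2
    simp only [Matrix.mul_one, Matrix.mul_zero, add_zero, zero_add, Matrix.mul_neg,
      Matrix.neg_mul] at h2
    rw [add_neg_eq_zero] at h2
    constructor
    · rw [← h1, ← h2, ← two_smul ℂ, smul_smul]; norm_num
    · rw [← h1, h2, ← two_smul ℂ, smul_smul]; norm_num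
  refine ⟨fun k => (Real.sqrt 2 : ℂ) • (F k).toRows₁, fun k => (Real.sqrt 2 : ℂ) • (F k).toRows₂,
    fun k => sqrt_two_smul_isometry (hrows k).1, fun k => sqrt_two_smul_isometry (hrows k).2, ?_⟩
  simp only [Matrix.conjTranspose_smul, Matrix.smul_mul, Matrix.mul_smul, ← Finset.smul_sum, h,
    smul_zero]

theorem VanishingSum.add_tailSum {c c' : K → β → ℝ} (hc : ∀ k i, 0 ≤ c k i)
    (hc' : ∀ k i, 0 ≤ c' k i) (h : VanishingSum (β ⊕ γ) fun k => tailSum (c k))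
    (h' : VanishingSum (β ⊕ γ) fun k => tailSum (c' k)) :
    VanishingSum (β ⊕ γ) fun k => tailSum (c k + c' k) := by
  obtain ⟨u, v, hu, hv, h⟩ := h
  obtain ⟨u', v', hu', hv', h'⟩ := h'
  choose U hU hUu using fun k => exists_unitary_submatrix_inl (u k) (hu k)
  choose U' hU' hUu' using fun k => exists_unitary_submatrix_inl (u' k) (hu' k)
  choose P hPa hP hP0 hP1 using fun k => exists_analytic_unitary_path (hU k) (hU' k)
  choose Q hQa hQ hQ0 hQ1 using fun k => exists_analytic_unitary_path (hv k) (hv' k)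
  let g : ℝ → K × β × Bool → Matrix ((β ⊕ γ) ⊕ β) ((β ⊕ γ) ⊕ β) ℂ :=
    fun t j => pairFrame (P j.1 t) (Q j.1 t)
  have hg : ∀ j x y, AnalyticOnNhd ℝ (fun t => g t j x y) Set.univ := by
    intro j x y
    simp only [g, pairFrame, Matrix.mul_apply]
    refine Finset.analyticOnNhd_fun_sum _ fun z _ => AnalyticOnNhd.mul ?_ analyticOnNhd_const
    rcases x with x | x <;> rcases z with z | z
    · exact hPa _ _ _
    · exact analyticOnNhd_const
    · exact analyticOnNhd_const
    · exact hQa _ _ _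
  have r0 : RankBound (flagSet (firstCopy β γ) (swapCopies β γ)) (flagWeight c)
      (∑ k, ∑ i, c k i) (g 0) :=
    rankBound_pairFrame (U := fun k => P k 0) (V := fun k => Q k 0) hc (fun k => hP k 0)
      (fun k => hQ k 0) (by simpa only [hP0, hQ0, hUu] using h)
  have r1 : RankBound (flagSet (firstCopy β γ) (swapCopies β γ)) (flagWeight c')
      (∑ k, ∑ i, c' k i) (g 1) :=
    rankBound_pairFrame (U := fun k => P k 1) (V := fun k => Q k 1) hc' (fun k => hP k 1)
      (fun k => hQ k 1) (by simpa only [hP1, hQ1, hUu'] using h')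
  obtain ⟨x, hx⟩ := RankBound.exists_add (a := flagWeight c) (a' := flagWeight c')
    (fun j => hc _ _) (fun j => hc' _ _)
    (Finset.sum_nonneg fun k _ => Finset.sum_nonneg fun i _ => hc k i)
    (Finset.sum_nonneg fun k _ => Finset.sum_nonneg fun i _ => hc' k i) hg r0 r1
  have hsum : (∑ k, ∑ i, c k i) + ∑ k, ∑ i, c' k i = ∑ k, ∑ i, (c + c') k i := by
    simp only [Pi.add_apply, Finset.sum_add_distrib]
  rw [hsum] at hx
  have hx' : RankBound (flagSet (firstCopy β γ) (swapCopies β γ)) (flagWeight (c + c'))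
    (∑ k, ∑ i, (c + c') k i) fun j : K × β × Bool => pairFrame (P j.1 x) (Q j.1 x) := hx
  obtain ⟨F, hF, hF'⟩ := exists_balanced_of_rankBound (J := signMatrix (β ⊕ γ) β)
    (g := fun k => pairFrame (P k x) (Q k x)) (firstCopy β γ) (swapCopies β γ)
    swapCopies_swapCopies (fun i j => by simp [firstCopy, swapCopies]) (signMatrix_mul_self _ _)
    (conjTranspose_signMatrix _ _) (fun k => pairFrame_unitary (hP k x) (hQ k x))
    (fun k => signMatrix_mul_pairFrame _ _) (fun k i => add_nonneg (hc k i) (hc' k i)) hx'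
  exact vanishingSum_of_isotropicFrames hF hF'

end VanishingSum

section SingularValues

open scoped ComplexOrder

theorem eigsDesc_antitone {n : ℕ} {A : Matrix (Fin n) (Fin n) ℂ} (hA : A.IsHermitian) :
    Antitone (eigsDesc hA) := fun _ _ hij =>
  Tuple.monotone_sort hA.eigenvalues (Fin.rev_le_rev.2 hij)

theorem singularValues_antitone {p q : ℕ} (A : Matrix (Fin p) (Fin q) ℂ) :
    Antitone (singularValues A) := fun _ _ hij =>
  Real.sqrt_le_sqrt (eigsDesc_antitone _ hij)

theorem singularValues_nonneg {p q : ℕ} (A : Matrix (Fin p) (Fin q) ℂ) (i : Fin q) :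
    0 ≤ singularValues A i :=
  Real.sqrt_nonneg _

theorem singularValues_mul_self {p q : ℕ} (A : Matrix (Fin p) (Fin q) ℂ) (i : Fin q) :
    singularValues A i * singularValues A i =
      eigsDesc (Matrix.isHermitian_conjTranspose_mul_self A) i :=
  Real.mul_self_sqrt ((Matrix.posSemidef_conjTranspose_mul_self A).eigenvalues_nonneg _)

theorem exists_unitary_eigsDesc {n : ℕ} {A : Matrix (Fin n) (Fin n) ℂ} (hA : A.IsHermitian) :
    ∃ V : Matrix (Fin n) (Fin n) ℂ, Vᴴ * V = 1 ∧
      A = V * Matrix.diagonal (fun i => (eigsDesc hA i : ℂ)) * Vᴴ := by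
  obtain ⟨U, hU, -, hAU⟩ := hA.exists_unitary_diagonal
  let π : Equiv.Perm (Fin n) := Fin.revPerm.trans (Tuple.sort hA.eigenvalues)
  refine ⟨U.submatrix id π, ?_, ?_⟩
  · rw [Matrix.conjTranspose_submatrix, ← Matrix.submatrix_mul _ _ π id π Function.bijective_id,
      hU, Matrix.submatrix_one_equiv]
  · have hd : Matrix.diagonal (fun i => (eigsDesc hA i : ℂ)) =
        (Matrix.diagonal fun i => (hA.eigenvalues i : ℂ)).submatrix π π := by
      rw [Matrix.submatrix_diagonal_equiv]
      rfl
    rw [hd, Matrix.submatrix_mul_equiv, Matrix.conjTranspose_submatrix,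
      Matrix.submatrix_mul_equiv, Matrix.submatrix_id_id]
    exact hAU

theorem eq_of_antitone_of_map_eq {n : ℕ} {f g : Fin n → ℝ} (hf : Antitone f) (hg : Antitone g)
    (h : Finset.univ.val.map f = Finset.univ.val.map g) : f = g := by
  rw [Fin.univ_val_map, Fin.univ_val_map, Multiset.coe_eq_coe] at h
  exact List.ofFn_injective (h.eq_of_sortedGE hf.sortedGE_ofFn hg.sortedGE_ofFn)

theorem eigsDesc_eq {n : ℕ} {A : Matrix (Fin n) (Fin n) ℂ} (hA : A.IsHermitian)
    {V : Matrix (Fin n) (Fin n) ℂ} (hV : Vᴴ * V = 1) {d : Fin n → ℝ} (hd : Antitone d)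
    (h : A = V * Matrix.diagonal (fun i => (d i : ℂ)) * Vᴴ) : eigsDesc hA = d := by
  refine eq_of_antitone_of_map_eq (eigsDesc_antitone hA) hd ?_
  let π : Equiv.Perm (Fin n) := Fin.revPerm.trans (Tuple.sort hA.eigenvalues)
  have h1 : Finset.univ.val.map (eigsDesc hA) = Finset.univ.val.map hA.eigenvalues := by
    change Finset.univ.val.map (hA.eigenvalues ∘ π) = _
    rw [← Multiset.map_map, Multiset.map_univ_val_equiv]
  have h2 : A.charpoly.roots = Finset.univ.val.map fun i => (d i : ℂ) := by
    rw [h, Matrix.mul_assoc, Matrix.charpoly_mul_comm, Matrix.mul_assoc, hV, Matrix.mul_one,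
      Matrix.charpoly_diagonal, Polynomial.roots_prod _ _ (by
        simp [Finset.prod_ne_zero_iff, Polynomial.X_sub_C_ne_zero])]
    simp
  rw [hA.roots_charpoly_eq_eigenvalues] at h2
  rw [h1]
  have := congr_arg (Multiset.map Complex.re) h2
  simpa [Multiset.map_map, Function.comp_def] using this

theorem exists_isometry_mul_diagonal {β γ : Type*} [Fintype β] [LinearOrder β]
    [LocallyFiniteOrderBot β] [Fintype γ] [DecidableEq γ] (X : Matrix (β ⊕ γ) β ℂ) (σ : β → ℝ)
    (h : Xᴴ * X = Matrix.diagonal fun i => ((σ i * σ i : ℝ) : ℂ)) :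
    ∃ u : Matrix (β ⊕ γ) β ℂ, uᴴ * u = 1 ∧ X = u * Matrix.diagonal fun i => (σ i : ℂ) := by
  have hX : ∀ i j, ∑ x, star (X x i) * X x j = if i = j then ((σ i * σ i : ℝ) : ℂ) else 0 := by
    intro i j
    have := congr_fun (congr_fun h i) j
    rwa [Matrix.diagonal_apply] at this
  let W : Matrix (β ⊕ γ) (β ⊕ γ) ℂ :=
    Matrix.fromCols (Matrix.of fun x j => (σ j : ℂ)⁻¹ * X x j) 0
  obtain ⟨U, hU, hUW⟩ := exists_unitary_extension W (Sum.inl '' {j | σ j ≠ 0}) (by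
    rintro _ ⟨i, hi, rfl⟩ _ ⟨j, hj, rfl⟩
    have e : (Wᴴ * W) (Sum.inl i) (Sum.inl j) =
        (σ i : ℂ)⁻¹ * (σ j : ℂ)⁻¹ * ∑ x, star (X x i) * X x j := by
      rw [Matrix.mul_apply, Finset.mul_sum]
      refine Finset.sum_congr rfl fun x _ => ?_
      simp only [W, Matrix.conjTranspose_apply, Matrix.fromCols_apply_inl, Matrix.of_apply,
        star_mul', star_inv₀, Complex.star_def, Complex.conj_ofReal]
      ring
    have hi' : (σ i : ℂ) ≠ 0 := Complex.ofReal_ne_zero.2 hi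
    rw [e, hX]
    by_cases hij : i = j
    · subst hij
      rw [if_pos rfl, if_pos rfl]
      push_cast
      field_simp
    · rw [if_neg hij, if_neg (by simpa using hij), mul_zero])
  refine ⟨U.submatrix id Sum.inl, ?_, ?_⟩
  · rw [Matrix.conjTranspose_submatrix,
      ← Matrix.submatrix_mul _ _ Sum.inl id Sum.inl Function.bijective_id, hU]
    ext i j
    simp [Matrix.one_apply]
  · ext x j
    rw [Matrix.mul_diagonal, Matrix.submatrix_apply]
    by_cases hj : σ j = 0
    · have h0 := hX j j
      rw [if_pos rfl, hj, mul_zero, Complex.ofReal_zero] at h0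
      have h1 : X.col j = 0 := dotProduct_star_self_eq_zero.1 h0
      rw [hj, Complex.ofReal_zero, mul_zero]
      exact congr_fun h1 x
    · rw [id, hUW _ ⟨j, hj, rfl⟩]
      have : (σ j : ℂ) ≠ 0 := Complex.ofReal_ne_zero.2 hj
      simp only [W, Matrix.fromCols_apply_inl, Matrix.of_apply]
      field_simp

variable {p q : ℕ} {γ : Type*} [Fintype γ] [DecidableEq γ]

theorem exists_singularValueDecomposition (e : Fin q ⊕ γ ≃ Fin p)
    (A : Matrix (Fin p) (Fin q) ℂ) :
    ∃ (u : Matrix (Fin q ⊕ γ) (Fin q) ℂ) (v : Matrix (Fin q) (Fin q) ℂ), uᴴ * u = 1 ∧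
      vᴴ * v = 1 ∧ A.submatrix e id =
        u * Matrix.diagonal (fun j => (singularValues A j : ℂ)) * vᴴ := by
  obtain ⟨V, hV, hAV⟩ := exists_unitary_eigsDesc (Matrix.isHermitian_conjTranspose_mul_self A)
  have hA : (A.submatrix e id)ᴴ * A.submatrix e id = Aᴴ * A := by
    rw [Matrix.conjTranspose_submatrix, Matrix.submatrix_mul_equiv, Matrix.submatrix_id_id]
  obtain ⟨u, hu, hXu⟩ := exists_isometry_mul_diagonal (A.submatrix e id * V) (singularValues A)
    (by
      rw [Matrix.conjTranspose_mul, Matrix.mul_assoc, ← Matrix.mul_assoc (A.submatrix e id)ᴴ, hA,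
        hAV]
      simp only [singularValues_mul_self]
      rw [Matrix.mul_assoc, Matrix.mul_assoc, hV, Matrix.mul_one, ← Matrix.mul_assoc, hV,
        Matrix.one_mul])
  refine ⟨u, V, hu, hV, ?_⟩
  rw [← hXu, Matrix.mul_assoc, mul_eq_one_comm.1 hV, Matrix.mul_one]

theorem singularValues_eq (e : Fin q ⊕ γ ≃ Fin p) {u : Matrix (Fin q ⊕ γ) (Fin q) ℂ}
    {v : Matrix (Fin q) (Fin q) ℂ} (hu : uᴴ * u = 1) (hv : vᴴ * v = 1) {τ : Fin q → ℝ}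
    (hτ : Antitone τ) (hτ0 : ∀ j, 0 ≤ τ j) :
    singularValues ((u * Matrix.diagonal (fun j => (τ j : ℂ)) * vᴴ).submatrix e.symm id) = τ := by
  set A := (u * Matrix.diagonal (fun j => (τ j : ℂ)) * vᴴ).submatrix e.symm id with hA
  have hAA : Aᴴ * A = v * Matrix.diagonal (fun j => ((τ j * τ j : ℝ) : ℂ)) * vᴴ := by
    rw [hA, Matrix.conjTranspose_submatrix, Matrix.submatrix_mul_equiv, Matrix.submatrix_id_id,
      Matrix.conjTranspose_mul, Matrix.conjTranspose_mul, Matrix.conjTranspose_conjTranspose,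
      Matrix.diagonal_conjTranspose]
    have : v * (Matrix.diagonal (star fun j => (τ j : ℂ)) * uᴴ) *
        (u * Matrix.diagonal (fun j => (τ j : ℂ)) * vᴴ) =
        v * (Matrix.diagonal (star fun j => (τ j : ℂ)) * (uᴴ * u) *
          Matrix.diagonal (fun j => (τ j : ℂ))) * vᴴ := by
      simp only [Matrix.mul_assoc]
    rw [this, hu, Matrix.mul_one, Matrix.diagonal_mul_diagonal]
    simp
  ext j
  rw [singularValues, eigsDesc_eq _ hv
    (fun i j hij => mul_self_le_mul_self (hτ0 j) (hτ hij)) hAA, Real.sqrt_mul_self (hτ0 j)]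

theorem mem_singularCone_iff (e : Fin q ⊕ γ ≃ Fin p)
    (t : (Fin q → ℝ) × (Fin q → ℝ) × (Fin q → ℝ)) :
    t ∈ SingularCone p q ↔ (∀ k, Antitone (![t.1, t.2.1, t.2.2] k) ∧
      ∀ j, 0 ≤ ![t.1, t.2.1, t.2.2] k j) ∧
        VanishingSum (Fin q ⊕ γ) ![t.1, t.2.1, t.2.2] := by
  obtain ⟨t₁, t₂, t₃⟩ := t
  constructor
  · rintro ⟨A, B, C, hsum, rfl, rfl, rfl⟩
    have hM : ∀ k, ![singularValues A, singularValues B, singularValues C] k =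
        singularValues (![A, B, C] k) := by
      intro k; fin_cases k <;> rfl
    refine ⟨fun k => ?_, ?_⟩
    · simp only [hM]
      exact ⟨singularValues_antitone _, singularValues_nonneg _⟩
    · choose u v hu hv huv using fun k => exists_singularValueDecomposition e (![A, B, C] k)
      refine ⟨u, v, hu, hv, ?_⟩
      simp only [hM, ← huv]
      rw [Fin.sum_univ_three]
      exact congr_arg (fun M : Matrix (Fin p) (Fin q) ℂ => M.submatrix e id) hsum
  · rintro ⟨ht, u, v, hu, hv, huv⟩
    rw [Fin.sum_univ_three] at huv
    refine ⟨_, _, _, ?_, singularValues_eq e (hu 0) (hv 0) (ht 0).1 (ht 0).2,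
      singularValues_eq e (hu 1) (hv 1) (ht 1).1 (ht 1).2,
      singularValues_eq e (hu 2) (hv 2) (ht 2).1 (ht 2).2⟩
    exact congr_arg (fun M : Matrix (Fin q ⊕ γ) (Fin q) ℂ => M.submatrix e.symm id) huv

theorem exists_tailSum_eq {τ : Fin q → ℝ} (hτ : Antitone τ) (hτ0 : ∀ j, 0 ≤ τ j) :
    ∃ c : Fin q → ℝ, (∀ i, 0 ≤ c i) ∧ tailSum c = τ := by
  let f : ℕ → ℝ := fun i => if h : i < q then τ ⟨i, h⟩ else 0
  have hf : Antitone f := by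
    intro i j hij
    simp only [f]
    split_ifs with hj hi hi
    · exact hτ hij
    · omega
    · exact hτ0 _
    · exact le_rfl
  refine ⟨fun i => f i - f (i + 1), fun i => sub_nonneg.2 (hf (Nat.le_succ _)), ?_⟩
  ext j
  have h1 : tailSum (fun i : Fin q => f i - f (i + 1)) j =
      ∑ i ∈ Finset.range q, if (j : ℕ) ≤ i then f i - f (i + 1) else 0 := by
    rw [Finset.sum_range]
    rfl
  rw [h1, ← Finset.sum_filter]
  have h2 : (Finset.range q).filter (fun i => (j : ℕ) ≤ i) = Finset.Ico (j : ℕ) q := by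
    ext i; simp; tauto
  rw [h2, Finset.sum_Ico_eq_sub _ j.2.le, Finset.sum_range_sub', Finset.sum_range_sub']
  simp [f]

theorem VanishingSum.smul {α β K : Type*} [Fintype α] [Fintype β] [DecidableEq β] [Fintype K]
    {τ : K → β → ℝ} (h : VanishingSum α τ) (r : ℝ) : VanishingSum α (r • τ) := by
  obtain ⟨u, v, hu, hv, h⟩ := h
  refine ⟨u, v, hu, hv, ?_⟩
  have : ∀ k, Matrix.diagonal (fun j => ((r • τ) k j : ℂ)) =
      (r : ℂ) • Matrix.diagonal (fun j => (τ k j : ℂ)) := by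
    intro k
    rw [← Matrix.diagonal_smul]
    congr 1
    ext j
    simp
  simp only [this, Matrix.mul_smul, Matrix.smul_mul, ← Finset.smul_sum, h, smul_zero]

theorem SingularCone.smul_mem (e : Fin q ⊕ γ ≃ Fin p) {r : ℝ} (hr : 0 ≤ r)
    {t : (Fin q → ℝ) × (Fin q → ℝ) × (Fin q → ℝ)} (ht : t ∈ SingularCone p q) :
    r • t ∈ SingularCone p q := by
  rw [mem_singularCone_iff e] at ht ⊢
  have hr' : ![(r • t).1, (r • t).2.1, (r • t).2.2] = r • ![t.1, t.2.1, t.2.2] := by simp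
  rw [hr']
  exact ⟨fun k => ⟨(ht.1 k).1.const_smul hr, fun j => mul_nonneg hr ((ht.1 k).2 j)⟩, ht.2.smul r⟩

theorem SingularCone.add_mem (e : Fin q ⊕ γ ≃ Fin p)
    {t t' : (Fin q → ℝ) × (Fin q → ℝ) × (Fin q → ℝ)} (ht : t ∈ SingularCone p q)
    (ht' : t' ∈ SingularCone p q) : t + t' ∈ SingularCone p q := by
  rw [mem_singularCone_iff e] at ht ht' ⊢
  have hadd : ![(t + t').1, (t + t').2.1, (t + t').2.2] =
      ![t.1, t.2.1, t.2.2] + ![t'.1, t'.2.1, t'.2.2] := by simp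
  rw [hadd]
  refine ⟨fun k => ⟨(ht.1 k).1.add (ht'.1 k).1, fun j => add_nonneg ((ht.1 k).2 j)
    ((ht'.1 k).2 j)⟩, ?_⟩
  choose c hc hct using fun k => exists_tailSum_eq (ht.1 k).1 (ht.1 k).2
  choose c' hc' hct' using fun k => exists_tailSum_eq (ht'.1 k).1 (ht'.1 k).2
  have h := VanishingSum.add_tailSum (β := Fin q) (γ := γ) hc hc'
    (by simp only [hct]; exact ht.2) (by simp only [hct']; exact ht'.2)
  simp only [tailSum_add, hct, hct'] at h
  exact h

end SingularValues

/-- For `p ≥ q ≥ 1`, `Singular(p,q)` is a convex cone in `(ℝ^q)^3`: it is convex and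
stable under multiplication by nonnegative real scalars. -/
theorem singularCone_convex_cone (p q : ℕ) (hq : 1 ≤ q) (hpq : q ≤ p) :
    Convex ℝ (SingularCone p q) ∧
      ∀ c : ℝ, 0 ≤ c → ∀ t ∈ SingularCone p q, c • t ∈ SingularCone p q := by
  let e : Fin q ⊕ Fin (p - q) ≃ Fin p :=
    finSumFinEquiv.trans (finCongr (Nat.add_sub_cancel' hpq))
  exact ⟨fun x hx y hy a b ha hb _ => SingularCone.add_mem e (SingularCone.smul_mem e ha hx)
    (SingularCone.smul_mem e hb hy), fun c hc t ht => SingularCone.smul_mem e hc ht⟩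
end

section
/- For every q ≥ 1 there exists p₀ ≥ q such that Singular(p,q) = Singular(p₀,q) for every p ≥ p₀; in other words, the increasing family of cones Singular(p,q) stabilizes and Singular(∞,q) := ⋃_{p ≥ q} Singular(p,q) equals Singular(p₀,q). -/
open Matrix

/-- Singular values depend only on the Gram matrix. -/
theorem singularValues_eq_of_gram_eq {p p' q : ℕ} {A : Matrix (Fin p) (Fin q) ℂ}
    {A' : Matrix (Fin p') (Fin q) ℂ} (h : Aᴴ * A = A'ᴴ * A') :
    singularValues A = singularValues A' := by
  have key : ∀ {X Y : Matrix (Fin q) (Fin q) ℂ} (hX : X.IsHermitian) (hY : Y.IsHermitian),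
      X = Y → eigsDesc hX = eigsDesc hY := by
    rintro X _ hX hY rfl
    rfl
  unfold singularValues
  rw [key _ (isHermitian_conjTranspose_mul_self A') h]

open scoped MatrixOrder ComplexOrder in
/-- Every matrix with few enough columns has the same Gram matrix as one with a prescribed
number of rows. -/
theorem exists_gram_eq {m ι n : Type*} [Fintype m] [Fintype ι] [Fintype n] [DecidableEq ι]
    [DecidableEq n] (F : Matrix m ι ℂ) (e : ι ↪ n) :
    ∃ G : Matrix n ι ℂ, Gᴴ * G = Fᴴ * F := by
  obtain ⟨M, hM⟩ :=
    CStarAlgebra.nonneg_iff_eq_star_mul_self.mp (posSemidef_conjTranspose_mul_self F).nonneg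
  have hV : ((1 : Matrix n n ℂ).submatrix id e)ᴴ * (1 : Matrix n n ℂ).submatrix id e = 1 := by
    rw [conjTranspose_submatrix, conjTranspose_one,
      ← submatrix_mul _ _ _ _ _ Function.bijective_id, one_mul, submatrix_one e e.injective]
  refine ⟨(1 : Matrix n n ℂ).submatrix id e * M, ?_⟩
  rw [conjTranspose_mul, Matrix.mul_assoc, ← Matrix.mul_assoc _ _ M, hV, Matrix.one_mul, hM,
    star_eq_conjTranspose]

theorem singularCone_subset {p p' q : ℕ} (h : 2 * q ≤ p') :
    SingularCone p q ⊆ SingularCone p' q := by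
  rintro t ⟨A, B, C, hsum, hA, hB, hC⟩
  have hcard : Fintype.card (Fin q ⊕ Fin q) ≤ Fintype.card (Fin p') := by
    simpa [two_mul] using h
  obtain ⟨e⟩ := Function.Embedding.nonempty_of_card_le hcard
  obtain ⟨G, hG⟩ := exists_gram_eq (fromCols A B) e
  have gram : ∀ P : Matrix (Fin q ⊕ Fin q) (Fin q) ℂ,
      singularValues (G * P) = singularValues (fromCols A B * P) := fun P =>
    singularValues_eq_of_gram_eq <| by
      rw [conjTranspose_mul, conjTranspose_mul, Matrix.mul_assoc, ← Matrix.mul_assoc _ G, hG]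
      simp only [Matrix.mul_assoc]
  have hC' : C = -A - B := by rw [eq_neg_of_add_eq_zero_right hsum, neg_add, sub_eq_add_neg]
  let P (X Y : Matrix (Fin q) (Fin q) ℂ) : Matrix (Fin q ⊕ Fin q) (Fin q) ℂ := fromRows X Y
  have hP : P 1 0 + P 0 1 + P (-1) (-1) = 0 := by
    ext (i | i) j <;> simp [P]
  refine ⟨G * P 1 0, G * P 0 1, G * P (-1) (-1), ?_, ?_, ?_, ?_⟩
  · rw [← Matrix.mul_add, ← Matrix.mul_add, hP, Matrix.mul_zero]
  · rw [gram, fromCols_mul_fromRows]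
    simpa using hA
  · rw [gram, fromCols_mul_fromRows]
    simpa using hB
  · rw [gram, fromCols_mul_fromRows, ← hC, hC']
    simp [sub_eq_add_neg]

/-- For every `q ≥ 1` there exists `p₀ ≥ q` such that `Singular(p,q) = Singular(p₀,q)` for
every `p ≥ p₀`; in particular `Singular(∞,q) := ⋃_{p ≥ q} Singular(p,q)` equals
`Singular(p₀,q)`. -/
theorem singularCone_stabilizes (q : ℕ) (hq : 1 ≤ q) :
    ∃ p₀, q ≤ p₀ ∧ (∀ p, p₀ ≤ p → SingularCone p q = SingularCone p₀ q) ∧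
      (⋃ p, ⋃ (_ : q ≤ p), SingularCone p q) = SingularCone p₀ q := by
  refine ⟨2 * q, by omega, fun p hp =>
    (singularCone_subset le_rfl).antisymm (singularCone_subset hp), ?_⟩
  refine Set.Subset.antisymm (Set.iUnion₂_subset fun p _ => singularCone_subset le_rfl) ?_
  exact Set.subset_iUnion₂_of_subset (2 * q) (by omega) subset_rfl
end
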